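/- arXiv:1611.01837 — 2 statements merged into one kernel-verified Lean document; each statement's English description precedes it below -/
import Mathlib

section
/- Structure of the deformed Marcenko–Pastur density (Lemma 1.2): The function f(x) = −1/x + r_N^{-1}∑_{i=1}^M π({σ_i})/(x+σ_i^{-1}) is smooth on the M+1 open intervals I_1 = (−σ_1^{-1},0), I_i = (−σ_i^{-1},−σ_{i−1}^{-1}) for i = 2,…,M, and I_0 = ℝ̄ ∖ ⋃_{i=1}^M Ī_i (ℝ̄ = ℝ∪{∞}). Let 𝒞 ⊂ ℝ̄ be the multiset of critical points of f (a nondegenerate critical point counted once, a degenerate one twice; ∞ is a nondegenerate critical point when r_N = 1). Then: (Critical points) |𝒞 ∩ I_0| = |𝒞 ∩ I_1| = 1 and |𝒞 ∩ I_i| ∈ {0,2} for i = 2,…,M, so |𝒞| = 2p for some p; writing x_1 ≥ ⋯ ≥ x_{2p−1} for the critical points in I_1∪⋯∪I_M and x_{2p} for the one in I_0, (Ordering) the values a_k := f(x_k) satisfy a_1 ≥ ⋯ ≥ a_{2p}, moreover x_k = m(a_k) (with m(0) := ∞ if r_N = 1) and 0 ≤ a_k ≤ C for a constant C; (Structure of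 ρ) supp ρ ∩ (0,∞) = (⋃_{k=1}^p [a_{2k}, a_{2k−1}]) ∩ (0,∞). -/
open MeasureTheory Filter Topology

noncomputable section

/-- The deterministic function `f` of the deformed Marchenko–Pastur law,
`f(x) = -1/x + r_N⁻¹ ∫ t/(1+xt) dπ(t) = -1/x + N⁻¹ ∑ᵢ (x + σᵢ⁻¹)⁻¹`. -/
def fMP (N M : ℕ) (σ : Fin M → ℝ) (x : ℝ) : ℝ :=
  -x⁻¹ + (N : ℝ)⁻¹ * ∑ i, (x + (σ i)⁻¹)⁻¹

/-- One-based access to the population eigenvalues `σ_1 ≥ ⋯ ≥ σ_M`. -/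
def sigE (M : ℕ) (σ : Fin M → ℝ) (i : ℕ) : ℝ :=
  if h : 1 ≤ i ∧ i ≤ M then σ ⟨i - 1, by omega⟩ else 0

/-- The interval `I_i`, `1 ≤ i ≤ M`: `I_1 = (-σ_1⁻¹, 0)` and
`I_i = (-σ_i⁻¹, -σ_{i-1}⁻¹)` for `2 ≤ i ≤ M`. -/
def intI (M : ℕ) (σ : Fin M → ℝ) (i : ℕ) : Set ℝ :=
  if i = 1 then Set.Ioo (-(sigE M σ 1)⁻¹) 0
  else Set.Ioo (-(sigE M σ i)⁻¹) (-(sigE M σ (i - 1))⁻¹)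

/-- The real part of the interval `I_0 = ℝ̄ ∖ ⋃ᵢ Īᵢ`, namely
`(-∞, -σ_M⁻¹) ∪ (0, ∞)`. -/
def intI0 (M : ℕ) (σ : Fin M → ℝ) : Set ℝ :=
  Set.Iio (-(sigE M σ M)⁻¹) ∪ Set.Ioi 0

/-! ### The inverse transform and its normalised derivative -/

section RealAnalysis

variable {ι : Type*} [Fintype ι]

/-- `x ↦ -1/x + c ∑ᵢ 1/(x + sᵢ)`. -/
def mpInv (c : ℝ) (s : ι → ℝ) (x : ℝ) : ℝ := -x⁻¹ + c * ∑ i, (x + s i)⁻¹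

/-- `x² f'(x)`, where `f = mpInv c s`. -/
def mpSlope (c : ℝ) (s : ι → ℝ) (x : ℝ) : ℝ := 1 - c * ∑ i, (x / (x + s i)) ^ 2

/-- The derivative of `mpSlope c s`. -/
def mpSlopeDeriv (c : ℝ) (s : ι → ℝ) (x : ℝ) : ℝ := -(c * ∑ i, 2 * s i * x / (x + s i) ^ 3)

/-- `x` is not a pole of `mpInv c s`. -/
def MPRegular (s : ι → ℝ) (x : ℝ) : Prop := x ≠ 0 ∧ ∀ i, x + s i ≠ 0

variable {c : ℝ} {s : ι → ℝ} {x y : ℝ}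

lemma MPRegular.eventually (h : MPRegular s x) : ∀ᶠ y in 𝓝 x, MPRegular s y := by
  have h1 : ∀ᶠ y : ℝ in 𝓝 x, y ≠ 0 := eventually_ne_nhds h.1
  have h2 : ∀ i, ∀ᶠ y : ℝ in 𝓝 x, y + s i ≠ 0 := fun i =>
    (continuous_id.add continuous_const).continuousAt.eventually_ne (h.2 i)
  filter_upwards [h1, eventually_all.2 h2] with y hy1 hy2 using ⟨hy1, hy2⟩

lemma contDiffAt_mpInv (h : MPRegular s x) : ContDiffAt ℝ (⊤ : ℕ∞) (mpInv c s) x := by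
  unfold mpInv
  refine (contDiffAt_id.inv h.1).neg.add (contDiffAt_const.mul (ContDiffAt.sum fun i _ => ?_))
  exact (contDiffAt_id.add contDiffAt_const).inv (h.2 i)

lemma hasDerivAt_mpInv (h : MPRegular s x) :
    HasDerivAt (mpInv c s) (mpSlope c s x / x ^ 2) x := by
  have h1 : HasDerivAt (fun x : ℝ => -x⁻¹) (-(-(x ^ 2)⁻¹)) x := (hasDerivAt_inv h.1).neg
  have h2 : ∀ i ∈ (Finset.univ : Finset ι),
      HasDerivAt (fun x : ℝ => (x + s i)⁻¹) (-1 / (x + s i) ^ 2) x := fun i _ =>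
    ((hasDerivAt_id x).add_const (s i)).inv (h.2 i)
  refine (h1.add ((HasDerivAt.fun_sum h2).const_mul c)).congr_deriv ?_
  unfold mpSlope
  have hx := h.1
  have : ∀ i, -1 / (x + s i) ^ 2 = -((x / (x + s i)) ^ 2 / x ^ 2) := fun i => by
    have := h.2 i
    field_simp
  simp only [this, Finset.sum_neg_distrib, ← Finset.sum_div]
  field_simp
  ring

lemma continuousAt_mpInv (h : MPRegular s x) : ContinuousAt (mpInv c s) x :=
  (hasDerivAt_mpInv h).continuousAt

lemma hasDerivAt_mpSlope (h : ∀ i, x + s i ≠ 0) :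
    HasDerivAt (mpSlope c s) (mpSlopeDeriv c s x) x := by
  have h2 : ∀ i ∈ (Finset.univ : Finset ι),
      HasDerivAt (fun x : ℝ => (x / (x + s i)) ^ 2) (2 * s i * x / (x + s i) ^ 3) x := fun i _ => by
    have := h i
    refine (((hasDerivAt_id x).div ((hasDerivAt_id x).add_const (s i)) this).pow 2).congr_deriv ?_
    simp
    field_simp
  exact ((HasDerivAt.fun_sum h2).const_mul c).const_sub 1

lemma continuousAt_mpSlope (h : ∀ i, x + s i ≠ 0) : ContinuousAt (mpSlope c s) x :=
  (hasDerivAt_mpSlope h).continuousAt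

lemma hasDerivAt_mpSlopeDeriv (h : ∀ i, x + s i ≠ 0) :
    HasDerivAt (mpSlopeDeriv c s) (-(c * ∑ i, 2 * s i * (s i - 2 * x) / (x + s i) ^ 4)) x := by
  have h2 : ∀ i ∈ (Finset.univ : Finset ι),
      HasDerivAt (fun x : ℝ => 2 * s i * x / (x + s i) ^ 3)
        (2 * s i * (s i - 2 * x) / (x + s i) ^ 4) x := fun i _ => by
    have := h i
    refine (((hasDerivAt_id x).const_mul (2 * s i)).div
      (((hasDerivAt_id x).add_const (s i)).pow 3) (pow_ne_zero 3 this)).congr_deriv ?_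
    simp
    field_simp
    ring
  exact ((HasDerivAt.fun_sum h2).const_mul c).neg

lemma deriv_mpInv (h : MPRegular s x) : deriv (mpInv c s) x = mpSlope c s x / x ^ 2 :=
  (hasDerivAt_mpInv h).deriv

lemma deriv_mpInv_eq_zero_iff (h : MPRegular s x) :
    deriv (mpInv c s) x = 0 ↔ mpSlope c s x = 0 := by
  rw [deriv_mpInv h, div_eq_zero_iff]
  exact or_iff_left (pow_ne_zero 2 h.1)

lemma deriv_deriv_mpInv_eq_zero_iff (h : MPRegular s x) (h0 : mpSlope c s x = 0) :
    deriv (deriv (mpInv c s)) x = 0 ↔ mpSlopeDeriv c s x = 0 := by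
  have he : deriv (mpInv c s) =ᶠ[𝓝 x] fun y => mpSlope c s y / y ^ 2 := by
    filter_upwards [h.eventually] with y hy using deriv_mpInv hy
  have hd : HasDerivAt (fun y => mpSlope c s y / y ^ 2) (mpSlopeDeriv c s x / x ^ 2) x := by
    refine ((hasDerivAt_mpSlope h.2).div ((hasDerivAt_id x).pow 2)
      (pow_ne_zero 2 h.1)).congr_deriv ?_
    have := h.1
    simp [h0]
    field_simp
  rw [he.deriv_eq, hd.deriv, div_eq_zero_iff]
  exact or_iff_left (pow_ne_zero 2 h.1)

/-- Difference-quotient identity for `x ↦ -1/x + c ∑ᵢ 1/(x + sᵢ)` over any field. -/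
lemma inv_transform_sub {K : Type*} [Field K] (c : K) {s : ι → K} {x y : K} (hx0 : x ≠ 0)
    (hy0 : y ≠ 0) (hx : ∀ i, x + s i ≠ 0) (hy : ∀ i, y + s i ≠ 0) :
    x * y * ((-x⁻¹ + c * ∑ i, (x + s i)⁻¹) - (-y⁻¹ + c * ∑ i, (y + s i)⁻¹)) =
      (x - y) * (1 - c * ∑ i, x / (x + s i) * (y / (y + s i))) := by
  have : ∀ i, (x - y) * (x / (x + s i) * (y / (y + s i))) =
      - (x * y) * ((x + s i)⁻¹ - (y + s i)⁻¹) := fun i => by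
    have := hx i
    have := hy i
    field_simp
    ring
  have h2 : (x - y) * ∑ i, x / (x + s i) * (y / (y + s i)) =
      - (x * y) * (∑ i, (x + s i)⁻¹ - ∑ i, (y + s i)⁻¹) := by
    rw [Finset.mul_sum, Finset.sum_congr rfl fun i _ => this i, ← Finset.mul_sum,
      Finset.sum_sub_distrib]
  have h3 : x * y * (-x⁻¹ + y⁻¹) = x - y := by
    field_simp
    ring
  linear_combination h3 + c * h2

lemma mpInv_sub_mpInv (hx : MPRegular s x) (hy : MPRegular s y) :
    x * y * (mpInv c s x - mpInv c s y) =
      (x - y) * (1 - c * ∑ i, x / (x + s i) * (y / (y + s i))) :=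
  inv_transform_sub c hx.1 hy.1 hx.2 hy.2

lemma mpSlope_add_le (hc : 0 ≤ c) (x y : ℝ) :
    (mpSlope c s x + mpSlope c s y) / 2 ≤ 1 - c * ∑ i, x / (x + s i) * (y / (y + s i)) := by
  unfold mpSlope
  have : ∑ i, x / (x + s i) * (y / (y + s i)) ≤
      ∑ i, ((x / (x + s i)) ^ 2 + (y / (y + s i)) ^ 2) / 2 := by
    refine Finset.sum_le_sum fun i _ => ?_
    linarith [two_mul_le_add_sq (x / (x + s i)) (y / (y + s i))]
  rw [← Finset.sum_div, Finset.sum_add_distrib] at this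
  nlinarith [mul_le_mul_of_nonneg_left this hc]

lemma mpInv_le_of_mul_pos (hc : 0 ≤ c) (hx : MPRegular s x) (hy : MPRegular s y)
    (hgx : 0 ≤ mpSlope c s x) (hgy : 0 ≤ mpSlope c s y) (hxy : 0 < x * y) (hle : x ≤ y) :
    mpInv c s x ≤ mpInv c s y := by
  have h1 := mpInv_sub_mpInv (c := c) hx hy
  have h2 := mpSlope_add_le (s := s) hc x y
  have h3 : 0 ≤ 1 - c * ∑ i, x / (x + s i) * (y / (y + s i)) := by linarith
  have h4 : x * y * (mpInv c s x - mpInv c s y) ≤ 0 := by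
    rw [h1]; exact mul_nonpos_of_nonpos_of_nonneg (by linarith) h3
  linarith [nonpos_of_mul_nonpos_right h4 hxy]

lemma mpInv_lt_of_mul_pos (hc : 0 ≤ c) (hx : MPRegular s x) (hy : MPRegular s y)
    (hg : 0 < mpSlope c s x + mpSlope c s y) (hxy : 0 < x * y) (hlt : x < y) :
    mpInv c s x < mpInv c s y := by
  have h1 := mpInv_sub_mpInv (c := c) hx hy
  have h2 := mpSlope_add_le (s := s) hc x y
  have h3 : 0 < 1 - c * ∑ i, x / (x + s i) * (y / (y + s i)) := by linarith
  have h4 : x * y * (mpInv c s x - mpInv c s y) < 0 := by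
    rw [h1]; exact mul_neg_of_neg_of_pos (by linarith) h3
  linarith [(pos_iff_neg_of_mul_neg h4).1 hxy]

lemma mpInv_le_of_pos_of_neg (hc : 0 ≤ c) (hx : MPRegular s x) (hy : MPRegular s y)
    (hgx : 0 ≤ mpSlope c s x) (hgy : 0 ≤ mpSlope c s y) (hx0 : 0 < x) (hy0 : y < 0) :
    mpInv c s x ≤ mpInv c s y := by
  have h1 := mpInv_sub_mpInv (c := c) hx hy
  have h2 := mpSlope_add_le (s := s) hc x y
  have h3 : 0 ≤ 1 - c * ∑ i, x / (x + s i) * (y / (y + s i)) := by linarith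
  have h4 : 0 ≤ x * y * (mpInv c s x - mpInv c s y) := by
    rw [h1]; exact mul_nonneg (by linarith) h3
  have h5 : x * y < 0 := mul_neg_of_pos_of_neg hx0 hy0
  by_contra! h
  nlinarith [mul_neg_of_neg_of_pos h5 (sub_pos.2 h)]

lemma mul_mpInv (hx : MPRegular s x) :
    x * mpInv c s x = -1 + c * ∑ i, x / (x + s i) := by
  unfold mpInv
  have := hx.1
  simp only [div_eq_mul_inv, ← Finset.mul_sum]
  field_simp

lemma sum_div_le_of_mpSlope_nonneg (hc : 0 ≤ c) (hg : 0 ≤ mpSlope c s x) :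
    c * ∑ i, |x / (x + s i)| ≤ (c * Fintype.card ι + 1) / 2 := by
  unfold mpSlope at hg
  have : ∑ i, |x / (x + s i)| ≤ ∑ i, (1 + (x / (x + s i)) ^ 2) / 2 := by
    refine Finset.sum_le_sum fun i _ => ?_
    rw [← sq_abs (x / (x + s i))]
    linarith [two_mul_le_add_sq 1 |x / (x + s i)|]
  rw [← Finset.sum_div, Finset.sum_add_distrib] at this
  simp only [Finset.sum_const, Finset.card_univ, nsmul_eq_mul, mul_one] at this
  nlinarith [mul_le_mul_of_nonneg_left this hc]

lemma mpInv_nonneg_of_neg (hc : 0 ≤ c) (hx : MPRegular s x) (hg : 0 ≤ mpSlope c s x)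
    (hx0 : x < 0) (hcard : c * Fintype.card ι ≤ 1) : 0 ≤ mpInv c s x := by
  have h1 := sum_div_le_of_mpSlope_nonneg hc hg
  have h2 : c * ∑ i, x / (x + s i) ≤ c * ∑ i, |x / (x + s i)| :=
    mul_le_mul_of_nonneg_left (Finset.sum_le_sum fun i _ => le_abs_self _) hc
  have h3 := mul_mpInv (c := c) hx
  have h4 : x * mpInv c s x ≤ 0 := by linarith
  exact nonneg_of_mul_nonpos_right h4 hx0

lemma MPRegular.of_pos {κ : Type*} {t : κ → ℝ} (hs : ∀ i, 0 < t i) (hx : 0 < x) :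
    MPRegular t x :=
  ⟨hx.ne', fun i => (add_pos hx (hs i)).ne'⟩

lemma div_add_mem_Ioo (hs : 0 < y) (hx : 0 < x) : x / (x + y) ∈ Set.Ioo (0 : ℝ) 1 :=
  ⟨by positivity, by rw [div_lt_one (by positivity)]; linarith⟩

lemma mpInv_nonneg_of_pos (hc : 0 ≤ c) (hs : ∀ i, 0 < s i) (hg : mpSlope c s x ≤ 0)
    (hx0 : 0 < x) : 0 ≤ mpInv c s x := by
  have h3 := mul_mpInv (c := c) (MPRegular.of_pos hs hx0)
  unfold mpSlope at hg
  have h2 : c * ∑ i, (x / (x + s i)) ^ 2 ≤ c * ∑ i, x / (x + s i) := by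
    refine mul_le_mul_of_nonneg_left (Finset.sum_le_sum fun i _ => ?_) hc
    have := div_add_mem_Ioo (hs i) hx0
    nlinarith [this.1, this.2]
  have h4 : 0 ≤ x * mpInv c s x := by linarith
  exact nonneg_of_mul_nonneg_right h4 hx0

lemma mpInv_nonpos_of_pos (hc : 0 ≤ c) (hs : ∀ i, 0 < s i) (hx0 : 0 < x)
    (hcard : c * Fintype.card ι ≤ 1) : mpInv c s x ≤ 0 := by
  have h3 := mul_mpInv (c := c) (MPRegular.of_pos hs hx0)
  have h2 : c * ∑ i, x / (x + s i) ≤ c * ∑ _i : ι, 1 :=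
    mul_le_mul_of_nonneg_left (Finset.sum_le_sum fun i _ => (div_add_mem_Ioo (hs i) hx0).2.le) hc
  simp only [Finset.sum_const, Finset.card_univ, nsmul_eq_mul, mul_one] at h2
  have h4 : x * mpInv c s x ≤ 0 := by linarith
  exact nonpos_of_mul_nonpos_right h4 hx0

/-! ### Signs of the slope on the complementary intervals -/

lemma mpSlope_neg_of_sq_lt (hc : 0 < c) (i : ι) (hi : x + s i ≠ 0)
    (h : (x + s i) ^ 2 < c * x ^ 2) : mpSlope c s x < 0 := by
  unfold mpSlope
  have h1 : (x / (x + s i)) ^ 2 ≤ ∑ i, (x / (x + s i)) ^ 2 :=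
    Finset.single_le_sum (f := fun i => (x / (x + s i)) ^ 2) (fun i _ => sq_nonneg _)
      (Finset.mem_univ i)
  have h2 : 1 < c * (x / (x + s i)) ^ 2 := by
    rw [div_pow, ← mul_div_assoc, one_lt_div (by positivity)]
    exact h
  nlinarith [mul_le_mul_of_nonneg_left h1 hc.le]

lemma eventually_mpSlope_neg (hc : 0 < c) (i : ι) (hi : 0 < s i) :
    ∀ᶠ x in 𝓝[≠] (-s i), mpSlope c s x < 0 := by
  have h1 : ∀ᶠ x in 𝓝 (-s i), (x + s i) ^ 2 < c * x ^ 2 := by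
    have hc1 : ContinuousAt (fun x : ℝ => (x + s i) ^ 2) (-s i) := by fun_prop
    have hc2 : ContinuousAt (fun x : ℝ => c * x ^ 2) (-s i) := by fun_prop
    refine hc1.eventually_lt hc2 ?_
    simp only [neg_add_cancel]
    have : 0 < c * s i ^ 2 := by positivity
    simpa using this
  filter_upwards [nhdsWithin_le_nhds h1, self_mem_nhdsWithin] with x hx hx'
  refine mpSlope_neg_of_sq_lt hc i (fun h => hx' ?_) hx
  simp only [Set.mem_singleton_iff]; linarith

lemma mpSlopeDeriv_neg_of_pos [Nonempty ι] (hc : 0 < c) (hs : ∀ i, 0 < s i) (hx : 0 < x) :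
    mpSlopeDeriv c s x < 0 := by
  unfold mpSlopeDeriv
  rw [neg_lt_zero]
  refine mul_pos hc (Finset.sum_pos (fun i _ => ?_) Finset.univ_nonempty)
  have := hs i
  positivity

lemma mpSlopeDeriv_neg_of_lt [Nonempty ι] (hc : 0 < c) (hs : ∀ i, 0 < s i)
    (hx : ∀ i, x < -s i) : mpSlopeDeriv c s x < 0 := by
  unfold mpSlopeDeriv
  rw [neg_lt_zero]
  refine mul_pos hc (Finset.sum_pos (fun i _ => ?_) Finset.univ_nonempty)
  have h1 := hs i
  have h2 := hx i
  refine div_pos_of_neg_of_neg (by nlinarith) (Odd.pow_neg (by decide) (by linarith))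

lemma mpSlopeDeriv_pos_of_neg [Nonempty ι] (hc : 0 < c) (hs : ∀ i, 0 < s i)
    (hx0 : x < 0) (hx : ∀ i, -s i < x) : 0 < mpSlopeDeriv c s x := by
  unfold mpSlopeDeriv
  rw [neg_pos]
  refine mul_neg_of_pos_of_neg hc (Finset.sum_neg (fun i _ => ?_) Finset.univ_nonempty)
  have h1 := hs i
  have h2 := hx i
  exact div_neg_of_neg_of_pos (by nlinarith) (pow_pos (by linarith) 3)

lemma mpSlope_pos_of_pos [Nonempty ι] (hc : 0 < c) (hs : ∀ i, 0 < s i)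
    (hcard : c * Fintype.card ι ≤ 1) (hx : 0 < x) : 0 < mpSlope c s x := by
  unfold mpSlope
  have : ∑ i, (x / (x + s i)) ^ 2 < ∑ _i : ι, (1 : ℝ) := by
    refine Finset.sum_lt_sum_of_nonempty Finset.univ_nonempty fun i _ => ?_
    have := div_add_mem_Ioo (hs i) hx
    nlinarith [this.1, this.2]
  simp only [Finset.sum_const, Finset.card_univ, nsmul_eq_mul, mul_one] at this
  nlinarith [mul_lt_mul_of_pos_left this hc]

lemma mpSlope_neg_of_lt [Nonempty ι] (hc : 0 < c) (hs : ∀ i, 0 < s i)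
    (hcard : 1 ≤ c * Fintype.card ι) (hx : ∀ i, x < -s i) : mpSlope c s x < 0 := by
  unfold mpSlope
  have : ∑ _i : ι, (1 : ℝ) < ∑ i, (x / (x + s i)) ^ 2 := by
    refine Finset.sum_lt_sum_of_nonempty Finset.univ_nonempty fun i _ => ?_
    have h1 := hs i
    have h2 := hx i
    have : 1 < x / (x + s i) := by
      rw [one_lt_div_of_neg (by linarith)]; linarith
    nlinarith
  simp only [Finset.sum_const, Finset.card_univ, nsmul_eq_mul, mul_one] at this
  nlinarith [mul_lt_mul_of_pos_left this hc]

lemma tendsto_mpSlope {l : Filter ℝ} (hl : ∀ a : ℝ, Tendsto (fun x : ℝ => (x + a)⁻¹) l (𝓝 0))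
    (hne : ∀ᶠ x in l, MPRegular s x) :
    Tendsto (mpSlope c s) l (𝓝 (1 - c * Fintype.card ι)) := by
  have h1 : Tendsto (fun x => 1 - c * ∑ i, (1 - s i * (x + s i)⁻¹) ^ 2) l
      (𝓝 (1 - c * ∑ i : ι, (1 - s i * 0) ^ 2)) :=
    tendsto_const_nhds.sub (tendsto_const_nhds.mul (tendsto_finsetSum _ fun i _ =>
      (tendsto_const_nhds.sub (tendsto_const_nhds.mul (hl (s i)))).pow 2))
  simp only [mul_zero, sub_zero, one_pow, Finset.sum_const, Finset.card_univ, nsmul_eq_mul,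
    mul_one] at h1
  refine h1.congr' ?_
  filter_upwards [hne] with x hx
  unfold mpSlope
  congr 2
  refine Finset.sum_congr rfl fun i _ => ?_
  have := hx.2 i
  field_simp
  ring

lemma tendsto_mpSlope_atTop (hs : ∀ i, 0 < s i) :
    Tendsto (mpSlope c s) atTop (𝓝 (1 - c * Fintype.card ι)) :=
  tendsto_mpSlope
    (fun a => tendsto_inv_atTop_zero.comp (tendsto_atTop_add_const_right _ a tendsto_id))
    ((eventually_gt_atTop 0).mono fun _ hx => MPRegular.of_pos hs hx)

lemma eventually_atBot_mpRegular (s : ι → ℝ) : ∀ᶠ x in atBot, MPRegular s x := by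
  filter_upwards [eventually_lt_atBot 0,
    eventually_all.2 fun i => eventually_lt_atBot (-s i)] with x h0 h
  exact ⟨h0.ne, fun i => by linarith [h i] |> fun h : x + s i < 0 => h.ne⟩

lemma tendsto_mpSlope_atBot : Tendsto (mpSlope c s) atBot (𝓝 (1 - c * Fintype.card ι)) :=
  tendsto_mpSlope
    (fun a => tendsto_inv_atBot_zero.comp (tendsto_atBot_add_const_right _ a tendsto_id))
    (eventually_atBot_mpRegular s)

lemma tendsto_mpInv_atBot : Tendsto (mpInv c s) atBot (𝓝 0) := by
  have h1 : Tendsto (fun x : ℝ => -x⁻¹ + c * ∑ i, (x + s i)⁻¹) atBot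
      (𝓝 (-0 + c * ∑ _i : ι, 0)) :=
    tendsto_inv_atBot_zero.neg.add (tendsto_const_nhds.mul (tendsto_finsetSum _ fun i _ =>
      tendsto_inv_atBot_zero.comp (tendsto_atBot_add_const_right _ (s i) tendsto_id)))
  simp only [neg_zero, Finset.sum_const_zero, mul_zero, add_zero] at h1
  exact h1

end RealAnalysis

/-! ### Boundary behaviour of the Stieltjes transform -/

section Boundary

variable {ι : Type*} [Fintype ι]

/-- The complex extension of `mpSlope`: it equals `|w|² · Im F(w) / Im w` off the real axis, where
`F(w) = -1/w + c ∑ᵢ 1/(w + sᵢ)`. -/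
def mpSlopeC (c : ℝ) (s : ι → ℝ) (w : ℂ) : ℝ := 1 - c * ∑ i, ‖w / (w + s i)‖ ^ 2

variable {c : ℝ} {s : ι → ℝ} {x x₀ : ℝ} {w z : ℂ} {m : ℂ → ℂ}

lemma mpSlopeC_ofReal (x : ℝ) : mpSlopeC c s (x : ℂ) = mpSlope c s x := by
  unfold mpSlopeC mpSlope
  congr 2
  refine Finset.sum_congr rfl fun i _ => ?_
  rw [← Complex.ofReal_add, ← Complex.ofReal_div, Complex.norm_real, Real.norm_eq_abs, sq_abs]

lemma continuousAt_mpSlopeC (h : ∀ i, w + s i ≠ 0) : ContinuousAt (mpSlopeC c s) w := by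
  unfold mpSlopeC
  refine continuousAt_const.sub (continuousAt_const.mul (tendsto_finsetSum _ fun i _ => ?_))
  exact ((continuousAt_id.div (continuousAt_id.add continuousAt_const) (h i)).norm.pow 2)

lemma add_ofReal_ne_zero_of_im_pos (hw : 0 < w.im) (a : ℝ) : w + a ≠ 0 := fun h => by
  have := congrArg Complex.im h
  simp at this
  linarith

lemma ne_zero_of_im_pos (hw : 0 < w.im) : w ≠ 0 := by
  simpa using add_ofReal_ne_zero_of_im_pos hw 0

lemma im_mul_norm_sq (hw : 0 < w.im) (hz : -w⁻¹ + c * ∑ i, (w + s i)⁻¹ = z) :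
    z.im * ‖w‖ ^ 2 = w.im * mpSlopeC c s w := by
  have hw0 := ne_zero_of_im_pos hw
  have hn : ‖w‖ ≠ 0 := norm_ne_zero_iff.2 hw0
  have h1 : ∀ i, ((w + s i)⁻¹).im * ‖w‖ ^ 2 = -(w.im * ‖w / (w + s i)‖ ^ 2) := fun i => by
    rw [Complex.inv_im, Complex.normSq_eq_norm_sq, norm_div, div_pow]
    simp only [Complex.add_im, Complex.ofReal_im, add_zero]
    ring
  have h2 : (∑ i, (w + s i)⁻¹).im * ‖w‖ ^ 2 = -(w.im * ∑ i, ‖w / (w + s i)‖ ^ 2) := by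
    rw [Complex.im_sum, Finset.sum_mul, Finset.sum_congr rfl fun i _ => h1 i,
      Finset.sum_neg_distrib, ← Finset.mul_sum]
  have h3 : (-w⁻¹).im * ‖w‖ ^ 2 = w.im := by
    rw [Complex.neg_im, Complex.inv_im, Complex.normSq_eq_norm_sq]
    field_simp
  rw [← hz, Complex.add_im, Complex.im_ofReal_mul, mpSlopeC]
  linear_combination h3 + c * h2

lemma mpSlopeC_pos (hw : 0 < w.im) (hzim : 0 < z.im)
    (hz : -w⁻¹ + c * ∑ i, (w + s i)⁻¹ = z) : 0 < mpSlopeC c s w := by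
  have h := im_mul_norm_sq hw hz
  have hn : 0 < ‖w‖ := norm_pos_iff.2 (ne_zero_of_im_pos hw)
  exact pos_of_mul_pos_right (h ▸ by positivity) hw.le

/-- Stability of the equation `F(w) = z` near a real point of nonnegative slope. -/
lemma norm_sub_pow_three_le (hc : 0 ≤ c) (hw : 0 < w.im) (hzim : 0 < z.im)
    (hz : -w⁻¹ + c * ∑ i, (w + s i)⁻¹ = z) (hx : MPRegular s x) (hg : 0 ≤ mpSlope c s x) (i : ι) :
    c * s i ^ 2 * ‖w - x‖ ^ 3 ≤
      2 * ‖z - mpInv c s x‖ * |x| * ‖w‖ * ‖w + s i‖ ^ 2 * (x + s i) ^ 2 := by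
  have hw0 := ne_zero_of_im_pos hw
  have hws := fun i => add_ofReal_ne_zero_of_im_pos hw (s i)
  have hwx : w - x ≠ 0 := by
    simpa [sub_eq_add_neg] using add_ofReal_ne_zero_of_im_pos hw (-x)
  have hd : 0 < ‖w - x‖ := norm_pos_iff.2 hwx
  have hid := inv_transform_sub (c : ℂ) (s := fun i => (s i : ℂ)) (x := w) (y := x) hw0
    (by exact_mod_cast hx.1) hws (fun i => by exact_mod_cast hx.2 i)
  have hf : -(x : ℂ)⁻¹ + c * ∑ i, ((x : ℂ) + s i)⁻¹ = (mpInv c s x : ℝ) := by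
    simp [mpInv]
  rw [hz, hf] at hid
  have hS := mpSlopeC_pos hw hzim hz
  set S : ℂ := (c : ℂ) * ∑ i, w / (w + s i) * ((x : ℂ) / (x + s i)) with hSdef
  have hre : (1 - S).re ≤ ‖w‖ * |x| * ‖z - mpInv c s x‖ / ‖w - x‖ := by
    refine (Complex.re_le_norm _).trans (le_of_eq ?_)
    rw [eq_div_iff hd.ne', mul_comm, ← norm_mul, ← hid]
    simp
  have hexp : ∀ j, ‖w / (w + s j) - ((x / (x + s j) : ℝ) : ℂ)‖ ^ 2 =
      ‖w / (w + s j)‖ ^ 2 + (x / (x + s j)) ^ 2 -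
        2 * (w / (w + s j) * ((x : ℂ) / (x + s j))).re := fun j => by
    rw [← Complex.normSq_eq_norm_sq, Complex.normSq_sub, Complex.normSq_eq_norm_sq,
      Complex.conj_ofReal, Complex.normSq_ofReal]
    push_cast
    ring
  have hsum : c * ∑ j, ‖w / (w + s j) - ((x / (x + s j) : ℝ) : ℂ)‖ ^ 2 =
      2 * (1 - S).re - mpSlopeC c s w - mpSlope c s x := by
    rw [Finset.sum_congr rfl fun j _ => hexp j, Finset.sum_sub_distrib, Finset.sum_add_distrib,
      ← Finset.mul_sum, ← Complex.re_sum, Complex.sub_re, hSdef, Complex.re_ofReal_mul, mpSlopeC,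
      mpSlope, Complex.one_re]
    ring
  have hone : c * ‖w / (w + s i) - ((x / (x + s i) : ℝ) : ℂ)‖ ^ 2 ≤
      2 * (‖w‖ * |x| * ‖z - mpInv c s x‖ / ‖w - x‖) := by
    have := Finset.single_le_sum
      (f := fun j => ‖w / (w + s j) - ((x / (x + s j) : ℝ) : ℂ)‖ ^ 2)
      (fun j _ => sq_nonneg _) (Finset.mem_univ i)
    have := mul_le_mul_of_nonneg_left this hc
    linarith
  have hxi : (x : ℂ) + s i ≠ 0 := by exact_mod_cast hx.2 i
  have hq : w / (w + s i) - ((x / (x + s i) : ℝ) : ℂ) =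
      s i * (w - x) / ((w + s i) * ((x + s i : ℝ) : ℂ)) := by
    push_cast
    have := hws i
    field_simp
    ring
  have hwi : 0 < ‖w + s i‖ := norm_pos_iff.2 (hws i)
  have hxi' : 0 < (x + s i) ^ 2 := pow_pos (abs_pos.2 (hx.2 i)) 2 |>.trans_eq (sq_abs _)
  rw [hq, norm_div, norm_mul, norm_mul, Complex.norm_real, Complex.norm_real, div_pow, mul_pow,
    mul_pow, Real.norm_eq_abs, Real.norm_eq_abs, sq_abs, sq_abs, ← mul_div_assoc,
    ← mul_div_assoc, div_le_div_iff₀ (by positivity) hd] at hone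
  linarith

/-- `m` is a right inverse of `F(w) = -1/w + c ∑ᵢ 1/(w + sᵢ)` on the upper half-plane. -/
structure MPTransform (c : ℝ) (s : ι → ℝ) (m : ℂ → ℂ) : Prop where
  im_pos : ∀ z : ℂ, 0 < z.im → 0 < (m z).im
  apply_eq : ∀ z : ℂ, 0 < z.im → -(m z)⁻¹ + c * ∑ i, (m z + s i)⁻¹ = z

lemma MPTransform.tendsto [Nonempty ι] (hm : MPTransform c s m) (hc : 0 < c) (hs : ∀ i, 0 < s i)
    (hx : MPRegular s x) (hg : 0 ≤ mpSlope c s x) :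
    Tendsto m (𝓝[{z : ℂ | 0 < z.im}] (mpInv c s x : ℝ)) (𝓝 (x : ℂ)) := by
  obtain ⟨i⟩ := ‹Nonempty ι›
  rw [Metric.tendsto_nhds]
  intro δ hδ
  set K := 2 * |x| * (1 + |x| / δ) * (1 + |x + s i| / δ) ^ 2 * (x + s i) ^ 2 with hK
  have hcs : 0 < c * s i ^ 2 := mul_pos hc (pow_pos (hs i) 2)
  have hsmall : ∀ᶠ z : ℂ in 𝓝 ((mpInv c s x : ℝ) : ℂ), K * ‖z - mpInv c s x‖ < c * s i ^ 2 := by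
    have : ContinuousAt (fun z : ℂ => K * ‖z - mpInv c s x‖) (mpInv c s x : ℝ) := by fun_prop
    refine this.eventually_lt continuousAt_const ?_
    simpa using hcs
  filter_upwards [nhdsWithin_le_nhds hsmall, self_mem_nhdsWithin] with z hz hzim
  rw [dist_eq_norm]
  by_contra! hd
  have h1 := norm_sub_pow_three_le hc.le (hm.im_pos z hzim) hzim (hm.apply_eq z hzim) hx hg i
  set d := ‖m z - x‖
  have hd0 : 0 < d := hδ.trans_le hd
  have hscale : ∀ b : ℝ, 0 ≤ b → d + b ≤ d * (1 + b / δ) := fun b hb => by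
    have : b ≤ d * (b / δ) := by
      rw [← mul_div_assoc, le_div_iff₀ hδ]
      nlinarith
    linarith
  have h2 : ‖m z‖ ≤ d * (1 + |x| / δ) := by
    refine le_trans ?_ (hscale _ (abs_nonneg x))
    have := norm_add_le (m z - x) (x : ℂ)
    simpa using this
  have h3 : ‖m z + s i‖ ≤ d * (1 + |x + s i| / δ) := by
    refine le_trans ?_ (hscale _ (abs_nonneg _))
    have := norm_add_le (m z - x) ((x + s i : ℝ) : ℂ)
    rw [Complex.norm_real, Real.norm_eq_abs] at this
    rwa [show m z - x + ((x + s i : ℝ) : ℂ) = m z + s i by push_cast; ring] at this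
  have h4 : c * s i ^ 2 * d ^ 3 ≤ K * ‖z - mpInv c s x‖ * d ^ 3 := by
    calc c * s i ^ 2 * d ^ 3 ≤
        2 * ‖z - mpInv c s x‖ * |x| * ‖m z‖ * ‖m z + s i‖ ^ 2 * (x + s i) ^ 2 := h1
      _ ≤ 2 * ‖z - mpInv c s x‖ * |x| * (d * (1 + |x| / δ)) * (d * (1 + |x + s i| / δ)) ^ 2 *
          (x + s i) ^ 2 := by gcongr
      _ = K * ‖z - mpInv c s x‖ * d ^ 3 := by rw [hK]; ring
  have h5 := le_of_mul_le_mul_right h4 (by positivity)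
  linarith

lemma tendsto_add_mul_I (a : ℝ) :
    Tendsto (fun η : ℝ => (a : ℂ) + η * Complex.I) (𝓝[>] 0) (𝓝[{z : ℂ | 0 < z.im}] (a : ℂ)) := by
  refine tendsto_nhdsWithin_iff.2 ⟨?_, ?_⟩
  · have : ContinuousAt (fun η : ℝ => (a : ℂ) + η * Complex.I) 0 := by fun_prop
    have h := this.tendsto
    simp only [Complex.ofReal_zero, zero_mul, add_zero] at h
    exact h.mono_left nhdsWithin_le_nhds
  · filter_upwards [self_mem_nhdsWithin] with η hη
    simpa using hη

/-! ### The support of a measure and its Stieltjes transform -/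

variable {ρ : Measure ℝ}

lemma im_inv_ofReal_sub (x : ℝ) (z : ℂ) :
    (((x : ℂ) - z)⁻¹).im = z.im / ‖(x : ℂ) - z‖ ^ 2 := by
  rw [Complex.inv_im, Complex.normSq_eq_norm_sq]
  simp

lemma im_le_norm_ofReal_sub (x : ℝ) (z : ℂ) : z.im ≤ ‖(x : ℂ) - z‖ := by
  have := Complex.abs_im_le_norm ((x : ℂ) - z)
  simp only [Complex.sub_im, Complex.ofReal_im, zero_sub, abs_neg] at this
  exact (le_abs_self _).trans this

lemma integrable_inv_ofReal_sub [IsFiniteMeasure ρ] (hz : 0 < z.im) :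
    Integrable (fun x : ℝ => ((x : ℂ) - z)⁻¹) ρ := by
  refine Integrable.of_bound (C := z.im⁻¹) ?_ (ae_of_all _ fun x => ?_)
  · exact Measurable.aestronglyMeasurable (by fun_prop)
  · rw [norm_inv]
    exact inv_anti₀ hz (im_le_norm_ofReal_sub x z)

lemma im_integral_inv_ofReal_sub [IsFiniteMeasure ρ] (hz : 0 < z.im) :
    (∫ x : ℝ, ((x : ℂ) - z)⁻¹ ∂ρ).im = ∫ x : ℝ, z.im / ‖(x : ℂ) - z‖ ^ 2 ∂ρ := by
  have h := integral_im (integrable_inv_ofReal_sub (ρ := ρ) hz)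
  simp only [RCLike.im_to_complex] at h
  rw [← h]
  exact integral_congr_ae (ae_of_all _ fun x => im_inv_ofReal_sub x z)

lemma measureReal_Icc_le [IsFiniteMeasure ρ] {y η : ℝ} (hη : 0 < η) :
    ρ.real (Set.Icc (y - η) (y + η)) ≤
      2 * η * (∫ x : ℝ, ((x : ℂ) - ((y : ℂ) + η * Complex.I))⁻¹ ∂ρ).im := by
  set z : ℂ := (y : ℂ) + η * Complex.I with hz
  have hzim : z.im = η := by simp [hz]
  have hzim' : 0 < z.im := hzim ▸ hη
  have hintegrable : Integrable (fun x : ℝ => z.im / ‖(x : ℂ) - z‖ ^ 2) ρ := by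
    refine (integrable_inv_ofReal_sub (ρ := ρ) hzim').im.congr (ae_of_all _ fun x => ?_)
    exact im_inv_ofReal_sub x z
  have h := mul_meas_ge_le_integral_of_nonneg (μ := ρ)
    (ae_of_all _ fun x => by simp only [Pi.zero_apply]; positivity) hintegrable (2 * η)⁻¹
  rw [← im_integral_inv_ofReal_sub hzim', inv_mul_le_iff₀ (by positivity)] at h
  refine le_trans (measureReal_mono fun x hx => ?_) h
  have hn : ‖(x : ℂ) - z‖ ^ 2 = (x - y) ^ 2 + η ^ 2 := by
    rw [← Complex.normSq_eq_norm_sq, Complex.normSq_apply]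
    simp [hz]
    ring
  simp only [Set.mem_ofPred_eq]
  rw [hn, hzim, inv_eq_one_div, div_le_div_iff₀ (by positivity) (by positivity)]
  have : (x - y) ^ 2 ≤ η ^ 2 := sq_le_sq' (by linarith [hx.1]) (by linarith [hx.2])
  nlinarith

/-- A finite measure which is quadratically small on short intervals vanishes. -/
lemma measureReal_Icc_eq_zero_of_le_sq [IsFiniteMeasure ρ] {K α β : ℝ}
    (h : ∀ a b, α ≤ a → a < b → b ≤ β → ρ.real (Set.Icc a b) ≤ K * (b - a) ^ 2) (hαβ : α < β) :
    ρ.real (Set.Icc α β) = 0 := by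
  have key : ∀ n : ℕ, ∀ a b, α ≤ a → a < b → b ≤ β →
      ρ.real (Set.Icc a b) ≤ K * (b - a) ^ 2 * (1 / 2) ^ n := by
    intro n
    induction n with
    | zero => simpa using h
    | succ n ih =>
      intro a b ha hab hb
      have h1 := ih a ((a + b) / 2) ha (by linarith) (by linarith)
      have h2 := ih ((a + b) / 2) b (by linarith) (by linarith) hb
      have h3 := measureReal_union_le (μ := ρ) (Set.Icc a ((a + b) / 2)) (Set.Icc ((a + b) / 2) b)
      rw [Set.Icc_union_Icc_eq_Icc (by linarith) (by linarith)] at h3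
      calc _ ≤ _ := h3.trans (add_le_add h1 h2)
        _ = _ := by ring
  have hlim : Tendsto (fun n : ℕ => K * (β - α) ^ 2 * (1 / 2 : ℝ) ^ n) atTop (𝓝 0) := by
    simpa using (tendsto_pow_atTop_nhds_zero_of_lt_one (by norm_num : (0 : ℝ) ≤ 1 / 2)
      (by norm_num)).const_mul (K * (β - α) ^ 2)
  exact le_antisymm (ge_of_tendsto' hlim fun n => key n α β le_rfl hαβ le_rfl) measureReal_nonneg

lemma MPTransform.exists_measure_Ioo_eq_zero [Nonempty ι] [IsFiniteMeasure ρ]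
    (hm : MPTransform c s m) (hρ : ∀ z : ℂ, 0 < z.im → m z = ∫ x : ℝ, ((x : ℂ) - z)⁻¹ ∂ρ)
    (hc : 0 < c) (hs : ∀ i, 0 < s i) (hx : MPRegular s x) (hg : 0 < mpSlope c s x) :
    ∃ ε > 0, ρ (Set.Ioo (mpInv c s x - ε) (mpInv c s x + ε)) = 0 := by
  have hlim := hm.tendsto hc hs hx hg.le
  have hxC : ∀ i, (x : ℂ) + s i ≠ 0 := fun i => by exact_mod_cast hx.2 i
  set K := ‖(x : ℂ)‖ ^ 2 / mpSlopeC c s x + 1 with hK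
  have hg' : 0 < mpSlopeC c s x := by rwa [mpSlopeC_ofReal]
  have hcont : ContinuousAt (fun w : ℂ => ‖w‖ ^ 2 / mpSlopeC c s w) x :=
    (continuousAt_id.norm.pow 2).div (continuousAt_mpSlopeC hxC) hg'.ne'
  have hev : ∀ᶠ w : ℂ in 𝓝 (x : ℂ), ‖w‖ ^ 2 / mpSlopeC c s w < K :=
    hcont.eventually_lt continuousAt_const (by rw [hK]; linarith)
  have hev2 := hlim.eventually hev
  rw [eventually_nhdsWithin_iff, Metric.eventually_nhds_iff] at hev2
  obtain ⟨δ, hδ, hball⟩ := hev2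
  set a := mpInv c s x
  have him : ∀ y η : ℝ, |y - a| < δ / 2 → 0 < η → η < δ / 2 →
      (m ((y : ℂ) + η * Complex.I)).im ≤ K * η := by
    intro y η hy hη hηδ
    have hzim : 0 < ((y : ℂ) + η * Complex.I).im := by simpa using hη
    have h1 := hball (y := (y : ℂ) + η * Complex.I) (by
      rw [dist_eq_norm]
      have : (y : ℂ) + η * Complex.I - (a : ℝ) = ((y - a : ℝ) : ℂ) + η * Complex.I := by
        push_cast; ring
      rw [this]
      refine (norm_add_le _ _).trans_lt ?_
      rw [Complex.norm_real, norm_mul, Complex.norm_real, Complex.norm_I, Real.norm_eq_abs,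
        Real.norm_eq_abs, abs_of_pos hη]
      linarith) hzim
    have h2 := im_mul_norm_sq (hm.im_pos _ hzim) (hm.apply_eq _ hzim)
    have h3 := mpSlopeC_pos (hm.im_pos _ hzim) hzim (hm.apply_eq _ hzim)
    rw [div_lt_iff₀ h3] at h1
    simp only [Complex.add_im, Complex.ofReal_im, Complex.mul_im, Complex.ofReal_re,
      Complex.I_im, Complex.I_re, mul_one, mul_zero, add_zero, zero_add] at h2
    refine le_of_mul_le_mul_right ?_ h3
    rw [← h2]
    nlinarith [mul_le_mul_of_nonneg_left h1.le hη.le]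
  have hzero : ρ.real (Set.Icc (a - δ / 4) (a + δ / 4)) = 0 := by
    refine measureReal_Icc_eq_zero_of_le_sq (K := K / 2) (fun u v hu huv hv => ?_) (by linarith)
    have h1 := measureReal_Icc_le (ρ := ρ) (y := (u + v) / 2) (η := (v - u) / 2) (by linarith)
    have hzim : 0 < ((((u + v) / 2 : ℝ) : ℂ) + ((v - u) / 2 : ℝ) * Complex.I).im := by
      simp; linarith
    rw [← hρ _ hzim] at h1
    have h2 := him ((u + v) / 2) ((v - u) / 2) (by rw [abs_lt]; constructor <;> linarith)
      (by linarith) (by linarith)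
    have h3 : (u + v) / 2 - (v - u) / 2 = u := by ring
    have h4 : (u + v) / 2 + (v - u) / 2 = v := by ring
    rw [h3, h4] at h1
    nlinarith [mul_le_mul_of_nonneg_left h2 (show 0 ≤ 2 * ((v - u) / 2) by linarith)]
  refine ⟨δ / 4, by linarith, ?_⟩
  rw [measureReal_eq_zero_iff] at hzero
  exact measure_mono_null Set.Ioo_subset_Icc_self hzero

lemma le_norm_of_notMem_Ioo {x ε : ℝ} (hx : x ∉ Set.Ioo (x₀ - ε) (x₀ + ε)) (η : ℝ) :
    ε ≤ ‖(x : ℂ) - ((x₀ : ℂ) + η * Complex.I)‖ := by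
  have h1 := Complex.abs_re_le_norm ((x : ℂ) - ((x₀ : ℂ) + η * Complex.I))
  simp only [Complex.sub_re, Complex.ofReal_re, Complex.add_re, Complex.mul_re, Complex.I_re,
    mul_zero, Complex.ofReal_im, Complex.I_im, mul_one, sub_self, add_zero] at h1
  refine le_trans ?_ h1
  by_contra! h
  rw [abs_lt] at h
  exact hx ⟨by linarith [h.1], by linarith [h.2]⟩

lemma MPTransform.exists_of_measure_Ioo_eq_zero [IsProbabilityMeasure ρ]
    (hm : MPTransform c s m) (hρ : ∀ z : ℂ, 0 < z.im → m z = ∫ x : ℝ, ((x : ℂ) - z)⁻¹ ∂ρ)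
    (hc : 0 < c) (hs : ∀ i, 0 < s i) {ε : ℝ} (hε : 0 < ε)
    (h0 : ρ (Set.Ioo (x₀ - ε) (x₀ + ε)) = 0) :
    ∃ x, MPRegular s x ∧ 0 < mpSlope c s x ∧ mpInv c s x = x₀ := by
  set W : ℝ := ∫ x : ℝ, (x - x₀)⁻¹ ∂ρ with hW
  have hae : ∀ᵐ x ∂ρ, x ∉ Set.Ioo (x₀ - ε) (x₀ + ε) := measure_eq_zero_iff_ae_notMem.1 h0
  have hzη : ∀ η : ℝ, 0 < η → 0 < ((x₀ : ℂ) + η * Complex.I).im := fun η hη => by simpa using hη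
  have hlim : Tendsto (fun η : ℝ => m ((x₀ : ℂ) + η * Complex.I)) (𝓝[>] 0) (𝓝 (W : ℂ)) := by
    have hWC : (W : ℂ) = ∫ x : ℝ, ((x : ℂ) - x₀)⁻¹ ∂ρ := by
      rw [hW, ← integral_complex_ofReal]
      push_cast
      rfl
    rw [hWC]
    have : Tendsto (fun η : ℝ => ∫ x : ℝ, ((x : ℂ) - ((x₀ : ℂ) + η * Complex.I))⁻¹ ∂ρ) (𝓝[>] 0)
        (𝓝 (∫ x : ℝ, ((x : ℂ) - x₀)⁻¹ ∂ρ)) := by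
      refine tendsto_integral_filter_of_dominated_convergence (fun _ => ε⁻¹) ?_ ?_
        (integrable_const _) ?_
      · exact Eventually.of_forall fun η => Measurable.aestronglyMeasurable (by fun_prop)
      · refine Eventually.of_forall fun η => hae.mono fun x hx => ?_
        rw [norm_inv]
        exact inv_anti₀ hε (le_norm_of_notMem_Ioo hx η)
      · refine hae.mono fun x hx => ?_
        have hne : (x : ℂ) - x₀ ≠ 0 := by
          have := le_norm_of_notMem_Ioo hx 0
          simp only [Complex.ofReal_zero, zero_mul, add_zero] at this
          exact norm_pos_iff.1 (hε.trans_le this)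
        exact (tendsto_const_nhds.sub
          ((tendsto_add_mul_I x₀).mono_right nhdsWithin_le_nhds)).inv₀ hne
    refine this.congr' ?_
    filter_upwards [self_mem_nhdsWithin] with η hη using (hρ _ (hzη η hη)).symm
  have hslope : ∀ η : ℝ, 0 < η → ε ^ 2 * ‖m ((x₀ : ℂ) + η * Complex.I)‖ ^ 2 ≤
      mpSlopeC c s (m ((x₀ : ℂ) + η * Complex.I)) := by
    intro η hη
    have hz := hzη η hη
    have h1 := im_mul_norm_sq (hm.im_pos _ hz) (hm.apply_eq _ hz)
    have h2 := mpSlopeC_pos (hm.im_pos _ hz) hz (hm.apply_eq _ hz)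
    have h3 : (m ((x₀ : ℂ) + η * Complex.I)).im ≤ η / ε ^ 2 := by
      rw [hρ _ hz, im_integral_inv_ofReal_sub hz]
      have : ∫ x : ℝ, ((x₀ : ℂ) + η * Complex.I).im / ‖(x : ℂ) - ((x₀ : ℂ) + η * Complex.I)‖ ^ 2 ∂ρ
          ≤ ∫ _x : ℝ, η / ε ^ 2 ∂ρ := by
        refine integral_mono_of_nonneg (ae_of_all _ fun x => ?_) (integrable_const _)
          (hae.mono fun x hx => ?_)
        · simp only [Pi.zero_apply]; positivity
        · have := le_norm_of_notMem_Ioo hx η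
          simp only [Complex.add_im, Complex.ofReal_im, Complex.mul_im, Complex.ofReal_re,
            Complex.I_im, Complex.I_re, mul_one, mul_zero, add_zero, zero_add]
          gcongr
      simpa using this
    simp only [Complex.add_im, Complex.ofReal_im, Complex.mul_im, Complex.ofReal_re,
      Complex.I_im, Complex.I_re, mul_one, mul_zero, add_zero, zero_add] at h1
    rw [le_div_iff₀ (by positivity)] at h3
    have h4 := mul_le_mul_of_nonneg_right h3 h2.le
    refine le_of_mul_le_mul_left ?_ hη
    nlinarith
  have hpos : ∀ᶠ η : ℝ in 𝓝[>] 0, 0 < η := self_mem_nhdsWithin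
  have hadd : ∀ i, W + s i ≠ 0 := by
    intro i hi
    have h1 : ∀ᶠ η : ℝ in 𝓝[>] 0, c * ‖m ((x₀ : ℂ) + η * Complex.I)‖ ^ 2 ≤
        ‖m ((x₀ : ℂ) + η * Complex.I) + s i‖ ^ 2 := by
      filter_upwards [hpos] with η hη
      have hz := hzη η hη
      have h2 := mpSlopeC_pos (hm.im_pos _ hz) hz (hm.apply_eq _ hz)
      set w := m ((x₀ : ℂ) + η * Complex.I)
      have hne : 0 < ‖w + s i‖ :=
        norm_pos_iff.2 (add_ofReal_ne_zero_of_im_pos (hm.im_pos _ hz) (s i))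
      have h3 := Finset.single_le_sum (f := fun j => ‖w / (w + s j)‖ ^ 2)
        (fun j _ => sq_nonneg _) (Finset.mem_univ i)
      have h4 := mul_le_mul_of_nonneg_left h3 hc.le
      unfold mpSlopeC at h2
      have h5 : c * ‖w / (w + s i)‖ ^ 2 ≤ 1 := by linarith
      rwa [norm_div, div_pow, ← mul_div_assoc, div_le_one (by positivity)] at h5
    have h2 := le_of_tendsto_of_tendsto (tendsto_const_nhds.mul (hlim.norm.pow 2))
      ((hlim.add tendsto_const_nhds).norm.pow 2) h1
    have h3 : (W : ℂ) + s i = 0 := by exact_mod_cast hi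
    rw [h3, Complex.norm_real, Real.norm_eq_abs, sq_abs, norm_zero] at h2
    have h4 : W = -s i := by linarith
    have := hs i
    rw [h4] at h2
    nlinarith [mul_pos hc (pow_pos this 2)]
  have haddC : ∀ i, (W : ℂ) + s i ≠ 0 := fun i => by exact_mod_cast hadd i
  have hmul : ∀ η : ℝ, 0 < η →
      -1 + c * ∑ i, m ((x₀ : ℂ) + η * Complex.I) / (m ((x₀ : ℂ) + η * Complex.I) + s i) =
      m ((x₀ : ℂ) + η * Complex.I) * ((x₀ : ℂ) + η * Complex.I) := by
    intro η hη
    have hz := hzη η hη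
    have hw0 : m ((x₀ : ℂ) + η * Complex.I) ≠ 0 := ne_zero_of_im_pos (hm.im_pos _ hz)
    have hz' := hm.apply_eq _ hz
    simp only [div_eq_mul_inv, ← Finset.mul_sum]
    linear_combination (m ((x₀ : ℂ) + η * Complex.I)) * hz' + mul_inv_cancel₀ hw0
  have heq : -1 + (c : ℂ) * ∑ i, (W : ℂ) / (W + s i) = W * x₀ := by
    refine tendsto_nhds_unique (f := fun η : ℝ => m ((x₀ : ℂ) + η * Complex.I) *
      ((x₀ : ℂ) + η * Complex.I)) (l := 𝓝[>] 0) ?_ ?_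
    · refine Tendsto.congr' (f₁ := fun η : ℝ => -1 + (c : ℂ) * ∑ i,
        m ((x₀ : ℂ) + η * Complex.I) / (m ((x₀ : ℂ) + η * Complex.I) + s i)) ?_ ?_
      · filter_upwards [hpos] with η hη using hmul η hη
      · exact tendsto_const_nhds.add (tendsto_const_nhds.mul (tendsto_finsetSum _ fun i _ =>
          hlim.div (hlim.add tendsto_const_nhds) (haddC i)))
    · exact hlim.mul ((tendsto_add_mul_I x₀).mono_right nhdsWithin_le_nhds)
  have heqR : -1 + c * ∑ i, W / (W + s i) = W * x₀ := by exact_mod_cast heq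
  have hW0 : W ≠ 0 := by
    intro h
    rw [h] at heqR
    simp at heqR
  have hreg : MPRegular s W := ⟨hW0, hadd⟩
  refine ⟨W, hreg, ?_, ?_⟩
  · have h1 : ε ^ 2 * ‖(W : ℂ)‖ ^ 2 ≤ mpSlopeC c s W := by
      refine le_of_tendsto_of_tendsto (tendsto_const_nhds.mul (hlim.norm.pow 2))
        ((continuousAt_mpSlopeC haddC).tendsto.comp hlim) ?_
      filter_upwards [hpos] with η hη using hslope η hη
    rw [mpSlopeC_ofReal] at h1
    have : 0 < ‖(W : ℂ)‖ := norm_pos_iff.2 (by exact_mod_cast hW0)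
    exact lt_of_lt_of_le (by positivity) h1
  · exact mul_left_cancel₀ hW0 ((mul_mpInv hreg).trans heqR)

/-- Points off the support are the values of `mpInv` at points of positive slope. -/
lemma MPTransform.measure_Ioo_pos_iff [Nonempty ι] [IsProbabilityMeasure ρ]
    (hm : MPTransform c s m) (hρ : ∀ z : ℂ, 0 < z.im → m z = ∫ x : ℝ, ((x : ℂ) - z)⁻¹ ∂ρ)
    (hc : 0 < c) (hs : ∀ i, 0 < s i) (x₀ : ℝ) :
    (∀ ε > (0 : ℝ), 0 < ρ (Set.Ioo (x₀ - ε) (x₀ + ε))) ↔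
      ¬ ∃ x, MPRegular s x ∧ 0 < mpSlope c s x ∧ mpInv c s x = x₀ := by
  constructor
  · rintro h ⟨x, hx, hg, rfl⟩
    obtain ⟨ε, hε, h0⟩ := hm.exists_measure_Ioo_eq_zero hρ hc hs hx hg
    exact (h ε hε).ne' h0
  · intro h ε hε
    rw [pos_iff_ne_zero]
    exact fun h0 => h (hm.exists_of_measure_Ioo_eq_zero hρ hc hs hε h0)

end Boundary

/-! ### Critical points of the inverse transform -/

section CriticalPoints

/-- `lo ≤ hi` are the zeros in `J`, counted with multiplicity, of a function `g` with derivative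
`g'`, and `g` is positive precisely between them. -/
structure IsZeroPair (g g' : ℝ → ℝ) (J : Set ℝ) (lo hi : ℝ) : Prop where
  lo_mem : lo ∈ J
  hi_mem : hi ∈ J
  le : lo ≤ hi
  lo_zero : g lo = 0
  hi_zero : g hi = 0
  eq_or_eq : ∀ x ∈ J, g x = 0 → x = lo ∨ x = hi
  pos_iff : ∀ x ∈ J, 0 < g x ↔ lo < x ∧ x < hi
  deriv_eq_zero : lo = hi → g' lo = 0
  deriv_ne_zero : lo < hi → g' lo ≠ 0 ∧ g' hi ≠ 0

/-- A strictly concave function on an open interval, negative near both endpoints, is negative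
or has a pair of zeros. -/
lemma forall_neg_or_exists_isZeroPair {g g' : ℝ → ℝ} {α β : ℝ}
    (hd : ∀ x ∈ Set.Ioo α β, HasDerivAt g (g' x) x) (hanti : StrictAntiOn g' (Set.Ioo α β))
    (hleft : ∀ w ∈ Set.Ioo α β, ∃ y ∈ Set.Ioo α w, g y < 0)
    (hright : ∀ w ∈ Set.Ioo α β, ∃ y ∈ Set.Ioo w β, g y < 0) :
    (∀ x ∈ Set.Ioo α β, g x < 0) ∨ ∃ lo hi, IsZeroPair g g' (Set.Ioo α β) lo hi := by
  have hcont : ContinuousOn g (Set.Ioo α β) := fun x hx => (hd x hx).continuousAt.continuousWithinAt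
  have hsub : ∀ {a b : ℝ}, a ∈ Set.Ioo α β → b ∈ Set.Ioo α β → Set.Icc a b ⊆ Set.Ioo α β :=
    fun ha hb x hx => ⟨ha.1.trans_le hx.1, hx.2.trans_lt hb.2⟩
  have hconc : StrictConcaveOn ℝ (Set.Ioo α β) g := by
    refine StrictAntiOn.strictConcaveOn_of_deriv (convex_Ioo α β) hcont ?_
    rw [interior_Ioo]
    exact hanti.congr fun x hx => (hd x hx).deriv.symm
  have hbetween : ∀ {a b y : ℝ}, a ∈ Set.Ioo α β → b ∈ Set.Ioo α β → a < y → y < b →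
      min (g a) (g b) < g y := fun ha hb hay hyb =>
    hconc.lt_on_openSegment ha hb (hay.trans hyb).ne
      (by rw [openSegment_eq_Ioo (hay.trans hyb)]; exact ⟨hay, hyb⟩)
  by_cases hpos : ∃ w ∈ Set.Ioo α β, 0 < g w
  · right
    obtain ⟨w, hw, hgw⟩ := hpos
    obtain ⟨y, hy, hgy⟩ := hleft w hw
    obtain ⟨y', hy', hgy'⟩ := hright w hw
    have hyJ : y ∈ Set.Ioo α β := ⟨hy.1, hy.2.trans hw.2⟩
    have hyJ' : y' ∈ Set.Ioo α β := ⟨hw.1.trans hy'.1, hy'.2⟩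
    obtain ⟨lo, hlo, hglo⟩ := intermediate_value_Ioo hy.2.le (hcont.mono (hsub hyJ hw)) ⟨hgy, hgw⟩
    obtain ⟨hi, hhi, hghi⟩ :=
      intermediate_value_Ioo' hy'.1.le (hcont.mono (hsub hw hyJ')) ⟨hgy', hgw⟩
    have hloJ := hsub hyJ hw ⟨hlo.1.le, hlo.2.le⟩
    have hhiJ := hsub hw hyJ' ⟨hhi.1.le, hhi.2.le⟩
    have hlt : lo < hi := hlo.2.trans hhi.1
    have hbelow : ∀ x ∈ Set.Ioo α β, x < lo → g x < 0 := fun x hx hxlo => by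
      by_contra! hgx
      have := hbetween hx hw hxlo hlo.2
      rw [hglo] at this
      exact absurd (le_min hgx hgw.le) (not_le.2 this)
    have habove : ∀ x ∈ Set.Ioo α β, hi < x → g x < 0 := fun x hx hxhi => by
      by_contra! hgx
      have := hbetween hw hx hhi.1 hxhi
      rw [hghi] at this
      exact absurd (le_min hgw.le hgx) (not_le.2 this)
    have hmid : ∀ x, lo < x → x < hi → 0 < g x := fun x h1 h2 => by
      simpa [hglo, hghi] using hbetween hloJ hhiJ h1 h2
    refine ⟨lo, hi, hloJ, hhiJ, hlt.le, hglo, hghi, fun x hx hgx => ?_, fun x hx => ⟨fun hgx => ?_,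
      fun h => hmid x h.1 h.2⟩, fun h => absurd h hlt.ne, fun _ => ⟨fun h => ?_, fun h => ?_⟩⟩
    · rcases lt_trichotomy x lo with h | h | h
      · exact absurd hgx (hbelow x hx h).ne
      · exact Or.inl h
      rcases lt_trichotomy x hi with h' | h' | h'
      · exact absurd hgx (hmid x h h').ne'
      · exact Or.inr h'
      · exact absurd hgx (habove x hx h').ne
    · constructor
      · by_contra! h
        rcases h.lt_or_eq with h | h
        · exact (hbelow x hx h).not_gt hgx
        · rw [h, hglo] at hgx; exact hgx.false
      · by_contra! h
        rcases h.lt_or_eq with h | h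
        · exact (habove x hx h).not_gt hgx
        · rw [← h, hghi] at hgx; exact hgx.false
    · obtain ⟨ξ, hξ, hξeq⟩ := exists_hasDerivAt_eq_slope g g' hlo.2 (hcont.mono (hsub hloJ hw))
        fun x hx => hd x (hsub hloJ hw ⟨hx.1.le, hx.2.le⟩)
      have h1 := hanti hloJ (hsub hloJ hw ⟨hξ.1.le, hξ.2.le⟩) hξ.1
      rw [h, hξeq, hglo, sub_zero] at h1
      exact absurd (div_pos hgw (sub_pos.2 hlo.2)) h1.not_gt
    · obtain ⟨ξ, hξ, hξeq⟩ := exists_hasDerivAt_eq_slope g g' hhi.1 (hcont.mono (hsub hw hhiJ))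
        fun x hx => hd x (hsub hw hhiJ ⟨hx.1.le, hx.2.le⟩)
      have h1 := hanti (hsub hw hhiJ ⟨hξ.1.le, hξ.2.le⟩) hhiJ hξ.2
      rw [h, hξeq, hghi, zero_sub] at h1
      exact absurd (div_neg_of_neg_of_pos (neg_lt_zero.2 hgw) (sub_pos.2 hhi.1)) h1.not_gt
  · push Not at hpos
    by_cases hz : ∃ x ∈ Set.Ioo α β, g x = 0
    · right
      obtain ⟨x, hx, hgx⟩ := hz
      have huniq : ∀ y ∈ Set.Ioo α β, g y = 0 → y = x := fun y hy hgy => by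
        by_contra hne
        rcases lt_or_gt_of_ne hne with h | h
        · have := hbetween (y := (x + y) / 2) hy hx (by linarith) (by linarith)
          rw [hgx, hgy, min_self] at this
          exact (hpos _ (hsub hy hx ⟨by linarith, by linarith⟩)).not_gt this
        · have := hbetween (y := (x + y) / 2) hx hy (by linarith) (by linarith)
          rw [hgx, hgy, min_self] at this
          exact (hpos _ (hsub hx hy ⟨by linarith, by linarith⟩)).not_gt this
      refine ⟨x, x, hx, hx, le_rfl, hgx, hgx, fun y hy hgy => Or.inl (huniq y hy hgy),
        fun y hy => ⟨fun h => absurd h (hpos y hy).not_gt, fun h => absurd (h.1.trans h.2)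
        (lt_irrefl _)⟩, fun _ => ?_, fun h => absurd h (lt_irrefl _)⟩
      have hmax : IsLocalMax g x := by
        filter_upwards [Ioo_mem_nhds hx.1 hx.2] with y hy
        rw [hgx]; exact hpos y hy
      exact hmax.hasDerivAt_eq_zero (hd x hx)
    · left
      push Not at hz
      exact fun x hx => lt_of_le_of_ne (hpos x hx) (hz x hx)

variable {ι : Type*} [Fintype ι] {c : ℝ} {s : ι → ℝ}

lemma exists_mpSlope_neg_right (hc : 0 < c) (i : ι) (hi : 0 < s i) {w : ℝ} (hw : -s i < w) :
    ∃ y ∈ Set.Ioo (-s i) w, mpSlope c s y < 0 := by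
  have h1 : ∀ᶠ x in 𝓝[>] (-s i), mpSlope c s x < 0 :=
    (eventually_mpSlope_neg hc i hi).filter_mono (nhdsWithin_mono _ fun x hx => ne_of_gt hx)
  obtain ⟨y, hy1, hy2⟩ := (h1.and (Ioo_mem_nhdsGT hw)).exists
  exact ⟨y, hy2, hy1⟩

lemma exists_mpSlope_neg_left (hc : 0 < c) (i : ι) (hi : 0 < s i) {w : ℝ} (hw : w < -s i) :
    ∃ y ∈ Set.Ioo w (-s i), mpSlope c s y < 0 := by
  have h1 : ∀ᶠ x in 𝓝[<] (-s i), mpSlope c s x < 0 :=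
    (eventually_mpSlope_neg hc i hi).filter_mono (nhdsWithin_mono _ fun x hx => ne_of_lt hx)
  obtain ⟨y, hy1, hy2⟩ := (h1.and (Ioo_mem_nhdsLT hw)).exists
  exact ⟨y, hy2, hy1⟩

lemma mpSlope_gap [Nonempty ι] (hc : 0 < c) (hs : ∀ i, 0 < s i) {i j : ι}
    (hgap : ∀ k, s k ≤ s j ∨ s i ≤ s k) :
    (∀ x ∈ Set.Ioo (-s i) (-s j), mpSlope c s x < 0) ∨
      ∃ lo hi, IsZeroPair (mpSlope c s) (mpSlopeDeriv c s) (Set.Ioo (-s i) (-s j)) lo hi := by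
  have hne : ∀ x ∈ Set.Ioo (-s i) (-s j), ∀ k, x + s k ≠ 0 := fun x hx k => by
    rcases hgap k with h | h
    · exact (show x + s k < 0 by linarith [hx.2]).ne
    · exact (show 0 < x + s k by linarith [hx.1]).ne'
  refine forall_neg_or_exists_isZeroPair (fun x hx => hasDerivAt_mpSlope (hne x hx)) ?_
    (fun w hw => exists_mpSlope_neg_right hc i (hs i) hw.1)
    (fun w hw => exists_mpSlope_neg_left hc j (hs j) hw.2)
  refine strictAntiOn_of_hasDerivWithinAt_neg (convex_Ioo _ _)
    (f' := fun x => -(c * ∑ i, 2 * s i * (s i - 2 * x) / (x + s i) ^ 4))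
    (fun x hx => (hasDerivAt_mpSlopeDeriv (hne x hx)).continuousAt.continuousWithinAt)
    (fun x hx => ?_) (fun x hx => ?_) <;> rw [interior_Ioo] at hx
  · exact (hasDerivAt_mpSlopeDeriv (hne x hx)).hasDerivWithinAt
  · rw [neg_lt_zero]
    refine mul_pos hc (Finset.sum_pos (fun k _ => ?_) Finset.univ_nonempty)
    have h1 := hs k
    have h2 := hne x hx k
    have h3 : 0 < s k - 2 * x := by linarith [hx.2, hs j]
    have h4 : 0 < (x + s k) ^ 4 := by positivity
    positivity

lemma mpSlope_first [Nonempty ι] (hc : 0 < c) (hs : ∀ i, 0 < s i) {i : ι}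
    (hmin : ∀ k, s i ≤ s k) :
    ∃ x ∈ Set.Ioo (-s i) 0, mpSlope c s x = 0 ∧
      (∀ y ∈ Set.Ioo (-s i) 0, mpSlope c s y = 0 → y = x) ∧
      ∀ y ∈ Set.Ioo (-s i) 0, 0 < mpSlope c s y ↔ x < y := by
  have hne : ∀ x ∈ Set.Ioc (-s i) 0, ∀ k, x + s k ≠ 0 := fun x hx k =>
    (show 0 < x + s k by linarith [hx.1, hmin k]).ne'
  have hcont : ContinuousOn (mpSlope c s) (Set.Ioc (-s i) 0) := fun x hx =>
    (continuousAt_mpSlope (hne x hx)).continuousWithinAt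
  have hmono : StrictMonoOn (mpSlope c s) (Set.Ioc (-s i) 0) := by
    refine strictMonoOn_of_hasDerivWithinAt_pos (convex_Ioc _ _) hcont
      (f' := mpSlopeDeriv c s) (fun x hx => ?_) (fun x hx => ?_) <;> rw [interior_Ioc] at hx
    · exact (hasDerivAt_mpSlope (hne x ⟨hx.1, hx.2.le⟩)).hasDerivWithinAt
    · exact mpSlopeDeriv_pos_of_neg hc hs hx.2 fun k => by linarith [hx.1, hmin k]
  have h0 : mpSlope c s 0 = 1 := by simp [mpSlope]
  obtain ⟨y, hy, hgy⟩ := exists_mpSlope_neg_right hc i (hs i) (neg_lt_zero.2 (hs i))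
  obtain ⟨x, hx, hgx⟩ := intermediate_value_Ioo hy.2.le
    (hcont.mono fun t ht => ⟨hy.1.trans_le ht.1, ht.2⟩) (show (0 : ℝ) ∈ _ from ⟨hgy, by
      rw [h0]; exact one_pos⟩)
  have hxJ : x ∈ Set.Ioc (-s i) 0 := ⟨hy.1.trans hx.1, hx.2.le⟩
  refine ⟨x, ⟨hxJ.1, hx.2⟩, hgx, fun t ht hgt => ?_, fun t ht => ?_⟩
  · exact hmono.injOn ⟨ht.1, ht.2.le⟩ hxJ (hgt.trans hgx.symm)
  · rw [← hgx]
    exact hmono.lt_iff_lt hxJ ⟨ht.1, ht.2.le⟩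

lemma mpSlope_strictAntiOn_pos [Nonempty ι] (hc : 0 < c) (hs : ∀ i, 0 < s i) :
    StrictAntiOn (mpSlope c s) (Set.Ici 0) := by
  have hne : ∀ x ∈ Set.Ici (0 : ℝ), ∀ k, x + s k ≠ 0 := fun x hx k =>
    (add_pos_of_nonneg_of_pos hx (hs k)).ne'
  refine strictAntiOn_of_hasDerivWithinAt_neg (convex_Ici _)
    (fun x hx => (continuousAt_mpSlope (hne x hx)).continuousWithinAt)
    (f' := mpSlopeDeriv c s) (fun x hx => ?_) (fun x hx => ?_) <;> rw [interior_Ici] at hx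
  · exact (hasDerivAt_mpSlope (hne x (Set.Ioi_subset_Ici_self hx))).hasDerivWithinAt
  · exact mpSlopeDeriv_neg_of_pos hc hs hx

lemma mpSlope_strictAntiOn_last [Nonempty ι] (hc : 0 < c) (hs : ∀ i, 0 < s i) {i : ι}
    (hmax : ∀ k, s k ≤ s i) : StrictAntiOn (mpSlope c s) (Set.Iio (-s i)) := by
  have hlt : ∀ x ∈ Set.Iio (-s i), ∀ k, x < -s k := fun x hx k => by
    have : x < -s i := hx
    linarith [hmax k]
  have hne : ∀ x ∈ Set.Iio (-s i), ∀ k, x + s k ≠ 0 := fun x hx k =>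
    (show x + s k < 0 by linarith [hlt x hx k]).ne
  refine strictAntiOn_of_hasDerivWithinAt_neg (convex_Iio _)
    (fun x hx => (continuousAt_mpSlope (hne x hx)).continuousWithinAt)
    (f' := mpSlopeDeriv c s) (fun x hx => ?_) (fun x hx => ?_) <;> rw [interior_Iio] at hx
  · exact (hasDerivAt_mpSlope (hne x hx)).hasDerivWithinAt
  · exact mpSlopeDeriv_neg_of_lt hc hs (hlt x hx)

lemma exists_mpSlope_zero_pos (hs : ∀ i, 0 < s i)
    (hcard : 1 < c * Fintype.card ι) : ∃ x, 0 < x ∧ mpSlope c s x = 0 := by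
  have h0 : mpSlope c s 0 = 1 := by simp [mpSlope]
  have h1 := (tendsto_mpSlope_atTop (c := c) hs).eventually_lt_const (u := 0) (by linarith)
  obtain ⟨y, hgy, hy⟩ := (h1.and (eventually_gt_atTop 0)).exists
  obtain ⟨x, hx, hgx⟩ := intermediate_value_Ioo' hy.le
    (fun t ht => (continuousAt_mpSlope fun k =>
      (add_pos_of_nonneg_of_pos ht.1 (hs k)).ne').continuousWithinAt)
    (show (0 : ℝ) ∈ _ from ⟨hgy, by rw [h0]; exact one_pos⟩)
  exact ⟨x, hx.1, hgx⟩

lemma exists_mpSlope_zero_last (hc : 0 < c) (hs : ∀ i, 0 < s i) {i : ι}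
    (hmax : ∀ k, s k ≤ s i) (hcard : c * Fintype.card ι < 1) :
    ∃ x < -s i, mpSlope c s x = 0 := by
  have h1 := (tendsto_mpSlope_atBot (c := c) (s := s)).eventually_const_lt (u := 0) (by linarith)
  obtain ⟨y, hgy, hy⟩ := (h1.and (eventually_lt_atBot (-s i))).exists
  obtain ⟨z, hz, hgz⟩ := exists_mpSlope_neg_left hc i (hs i) hy
  obtain ⟨x, hx, hgx⟩ := intermediate_value_Ioo' hz.1.le
    (fun t ht => (continuousAt_mpSlope fun k =>
      (show t + s k < 0 by linarith [hmax k, ht.2, hz.2]).ne).continuousWithinAt)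
    (show (0 : ℝ) ∈ _ from ⟨hgz, hgy⟩)
  exact ⟨x, hx.2.trans hz.2, hgx⟩

end CriticalPoints

/-! ### Spectral edges -/

section Edges

variable {ι : Type*} [Fintype ι] {c : ℝ} {s : ι → ℝ}

/-- The lowest edge `a`, attained at the critical point `x` outside the convex hull of the poles
when that critical point is finite. -/
lemma exists_last_edge [Nonempty ι] (hc : 0 < c) (hs : ∀ i, 0 < s i) {i : ι}
    (hmax : ∀ k, s k ≤ s i) :
    ∃ x a : ℝ,
      (c * Fintype.card ι ≠ 1 → (x < -s i ∨ 0 < x) ∧ mpSlope c s x = 0 ∧ a = mpInv c s x) ∧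
      (c * Fintype.card ι = 1 → a = 0) ∧ 0 ≤ a ∧
      (∀ w, MPRegular s w → -s i < w → w < 0 → 0 ≤ mpSlope c s w → a ≤ mpInv c s w) ∧
      (∀ y, y < -s i ∨ 0 < y → mpSlope c s y = 0 → c * Fintype.card ι ≠ 1 ∧ y = x) ∧
      (∀ t, 0 < t → t < a → ∃ w, MPRegular s w ∧ 0 < mpSlope c s w ∧ mpInv c s w = t) ∧
      (∀ w, w < -s i ∨ 0 < w → 0 < mpSlope c s w → 0 < mpInv c s w → mpInv c s w < a) := by
  have hlt : ∀ w, w < -s i → ∀ k, w < -s k := fun w hw k => by linarith [hmax k]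
  have hreg : ∀ w, w < -s i → MPRegular s w := fun w hw =>
    ⟨by linarith [hs i], fun k => (show w + s k < 0 by linarith [hlt w hw k]).ne⟩
  have hanti := mpSlope_strictAntiOn_last hc hs hmax
  have hanti0 := mpSlope_strictAntiOn_pos hc hs
  rcases lt_trichotomy (c * Fintype.card ι) 1 with hcard | hcard | hcard
  · obtain ⟨x, hx, hgx⟩ := exists_mpSlope_zero_last hc hs hmax hcard
    have hx0 : x < 0 := by linarith [hs i]
    refine ⟨x, mpInv c s x, fun _ => ⟨Or.inl hx, hgx, rfl⟩, fun h => absurd h hcard.ne,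
      mpInv_nonneg_of_neg hc.le (hreg x hx) hgx.ge hx0 hcard.le, fun w hw hwi hw0 hgw => ?_,
      fun y hy hgy => ⟨hcard.ne, ?_⟩, fun t ht hta => ?_, fun w hw hgw hfw => ?_⟩
    · exact mpInv_le_of_mul_pos hc.le (hreg x hx) hw hgx.ge hgw (mul_pos_of_neg_of_neg hx0 hw0)
        (by linarith)
    · rcases hy with hy | hy
      · exact hanti.injOn hy hx (hgy.trans hgx.symm)
      · exact absurd hgy (mpSlope_pos_of_pos hc hs hcard.le hy).ne'
    · obtain ⟨y, hfy, hy⟩ := ((tendsto_mpInv_atBot (c := c) (s := s)).eventually_lt_const ht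
        |>.and (eventually_lt_atBot x)).exists
      obtain ⟨w, hw, hfw⟩ := intermediate_value_Ioo hy.le
        (fun u hu => (continuousAt_mpInv (c := c)
          (hreg u (hu.2.trans_lt hx))).continuousWithinAt) ⟨hfy, hta⟩
      have hwi := hw.2.trans hx
      exact ⟨w, hreg w hwi, by rw [← hgx]; exact hanti hwi hx hw.2, hfw⟩
    · rcases hw with hw | hw
      · rw [← hgx] at hgw
        have hwx := (hanti.lt_iff_gt hx hw).1 hgw
        exact mpInv_lt_of_mul_pos hc.le (hreg w hw) (hreg x hx) (by linarith)
          (mul_pos_of_neg_of_neg (by linarith) hx0) hwx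
      · exact absurd hfw (mpInv_nonpos_of_pos hc.le hs hw hcard.le).not_gt
  · refine ⟨0, 0, fun h => absurd hcard h, fun _ => rfl, le_rfl, fun w hw hwi hw0 hgw =>
      mpInv_nonneg_of_neg hc.le hw hgw hw0 hcard.le, fun y hy hgy => ?_,
      fun t ht hta => absurd hta ht.not_gt, fun w hw hgw hfw => ?_⟩
    · rcases hy with hy | hy
      · exact absurd hgy (mpSlope_neg_of_lt hc hs hcard.ge (hlt y hy)).ne
      · exact absurd hgy (mpSlope_pos_of_pos hc hs hcard.le hy).ne'
    · rcases hw with hw | hw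
      · exact absurd hgw (mpSlope_neg_of_lt hc hs hcard.ge (hlt w hw)).not_gt
      · exact absurd hfw (mpInv_nonpos_of_pos hc.le hs hw hcard.le).not_gt
  · obtain ⟨x, hx, hgx⟩ := exists_mpSlope_zero_pos hs hcard
    have hxr := MPRegular.of_pos hs hx
    refine ⟨x, mpInv c s x, fun _ => ⟨Or.inr hx, hgx, rfl⟩, fun h => absurd h hcard.ne',
      mpInv_nonneg_of_pos hc.le hs hgx.le hx, fun w hw hwi hw0 hgw => ?_,
      fun y hy hgy => ⟨hcard.ne', ?_⟩, fun t ht hta => ?_, fun w hw hgw hfw => ?_⟩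
    · exact mpInv_le_of_pos_of_neg hc.le hxr hw hgx.ge hgw hx hw0
    · rcases hy with hy | hy
      · exact absurd hgy (mpSlope_neg_of_lt hc hs hcard.le (hlt y hy)).ne
      · exact hanti0.injOn (Set.mem_Ici.2 hy.le) (Set.mem_Ici.2 hx.le) (hgy.trans hgx.symm)
    · set K := c * ∑ k, (s k)⁻¹ with hK
      have hK0 : 0 ≤ K := mul_nonneg hc.le (Finset.sum_nonneg fun k _ => (inv_pos.2 (hs k)).le)
      set y := min (x / 2) (K + 1)⁻¹ with hy
      have hy0 : 0 < y := lt_min (by linarith) (by positivity)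
      have hyx : y < x := (min_le_left _ _).trans_lt (by linarith)
      have hfy : mpInv c s y < t := by
        have h1 : K + 1 ≤ y⁻¹ := by
          rw [le_inv_comm₀ (by positivity) hy0]
          exact min_le_right _ _
        have h2 : c * ∑ k, (y + s k)⁻¹ ≤ K :=
          mul_le_mul_of_nonneg_left (Finset.sum_le_sum fun k _ =>
            inv_anti₀ (hs k) (by linarith)) hc.le
        unfold mpInv
        linarith
      obtain ⟨w, hw, hfw⟩ := intermediate_value_Ioo hyx.le
        (fun u hu => (continuousAt_mpInv (c := c)
          (MPRegular.of_pos hs (hy0.trans_le hu.1))).continuousWithinAt) ⟨hfy, hta⟩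
      have hw0 := hy0.trans hw.1
      refine ⟨w, MPRegular.of_pos hs hw0, ?_, hfw⟩
      rw [← hgx]
      exact hanti0 (Set.mem_Ici.2 hw0.le) (Set.mem_Ici.2 hx.le) hw.2
    · rcases hw with hw | hw
      · exact absurd hgw (mpSlope_neg_of_lt hc hs hcard.le (hlt w hw)).not_gt
      · rw [← hgx] at hgw
        have hwx := (hanti0.lt_iff_gt (Set.mem_Ici.2 hx.le) (Set.mem_Ici.2 hw.le)).1 hgw
        exact mpInv_lt_of_mul_pos hc.le (MPRegular.of_pos hs hw) hxr (by linarith)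
          (mul_pos hw hx) hwx

/-- Every value above the first critical value is attained at a point of positive slope. -/
lemma exists_of_first_edge_lt (hc : 0 ≤ c) {i : ι} (hmin : ∀ k, s i ≤ s k)
    {x t : ℝ} (hx : x ∈ Set.Ioo (-s i) 0) (ht : 0 < t) (hxt : mpInv c s x < t)
    (hpos : ∀ y ∈ Set.Ioo (-s i) 0, x < y → 0 < mpSlope c s y) :
    ∃ w, MPRegular s w ∧ 0 < mpSlope c s w ∧ mpInv c s w = t := by
  have hreg : ∀ w ∈ Set.Ioo (-s i) 0, MPRegular s w := fun w hw =>
    ⟨hw.2.ne, fun k => (show 0 < w + s k by linarith [hmin k, hw.1]).ne'⟩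
  set y := max (x / 2) (-t⁻¹) with hy
  have hy0 : y < 0 := max_lt (by linarith [hx.2]) (neg_lt_zero.2 (inv_pos.2 ht))
  have hxy : x < y := lt_max_of_lt_left (by linarith [hx.2])
  have hfy : t ≤ mpInv c s y := by
    have h1 : t ≤ -y⁻¹ := by
      rw [← inv_neg, le_inv_comm₀ ht (by linarith)]
      linarith [le_max_right (x / 2) (-t⁻¹)]
    have h2 : 0 ≤ c * ∑ k, (y + s k)⁻¹ := mul_nonneg hc (Finset.sum_nonneg fun k _ =>
      inv_nonneg.2 (by linarith [hmin k, hx.1]))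
    unfold mpInv
    linarith
  obtain ⟨w, hw, hfw⟩ := intermediate_value_Ioc hxy.le
    (fun u hu => (continuousAt_mpInv (c := c)
      (hreg u ⟨hx.1.trans_le hu.1, hu.2.trans_lt hy0⟩)).continuousWithinAt) ⟨hxt, hfy⟩
  have hwJ : w ∈ Set.Ioo (-s i) 0 := ⟨hx.1.trans hw.1, hw.2.trans_lt hy0⟩
  exact ⟨w, hreg w hwJ, hpos w hwJ hw.1, hfw⟩

/-- Upper bound on the first critical value. -/
lemma mpInv_first_edge_le (hc : 0 ≤ c) {i : ι} (hmin : ∀ k, s i ≤ s k)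
    {x τ : ℝ} (hτ : 0 < τ) (hτ1 : τ ≤ 1) (hτs : τ ≤ s i) (hcard : c * Fintype.card ι ≤ τ⁻¹)
    (hx : x ∈ Set.Ioo (-s i) 0) (hg : mpSlope c s x = 0) :
    mpInv c s x ≤ (1 + (τ⁻¹ + 1) / 2) / (τ ^ 2 / 2) := by
  have hpos : ∀ k, 0 < x + s k := fun k => by linarith [hmin k, hx.1]
  have h1 : c * ∑ k, (x / (x + s k)) ^ 2 ≤ c * ∑ _k : ι, x ^ 2 / (x + s i) ^ 2 := by
    refine mul_le_mul_of_nonneg_left (Finset.sum_le_sum fun k _ => ?_) hc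
    rw [div_pow]
    have := hpos i
    have := hmin k
    gcongr
  have h2 : τ * (x + s i) ^ 2 ≤ x ^ 2 := by
    unfold mpSlope at hg
    rw [Finset.sum_const, Finset.card_univ, nsmul_eq_mul, ← mul_assoc] at h1
    have h3 : 0 < (x + s i) ^ 2 := pow_pos (hpos i) 2
    have h4 : 1 ≤ τ⁻¹ * (x ^ 2 / (x + s i) ^ 2) := by
      have : c * Fintype.card ι * (x ^ 2 / (x + s i) ^ 2) ≤ τ⁻¹ * (x ^ 2 / (x + s i) ^ 2) := by
        gcongr
      linarith
    rwa [← div_eq_inv_mul, le_div_iff₀ hτ, le_div_iff₀ h3, one_mul] at h4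
  have h3 : τ ^ 2 / 2 ≤ -x := by
    by_contra! h
    have h4 : τ / 2 < x + s i := by nlinarith
    have h5 : (τ / 2) ^ 2 < (x + s i) ^ 2 := by gcongr
    have h6 : x ^ 2 < (τ ^ 2 / 2) ^ 2 := sq_lt_sq' (by linarith) (by nlinarith [hx.2])
    nlinarith [mul_lt_mul_of_pos_left h5 hτ, pow_pos hτ 3]
  have hreg : MPRegular s x := ⟨hx.2.ne, fun k => (hpos k).ne'⟩
  have h4 := sum_div_le_of_mpSlope_nonneg hc hg.ge
  have h5 : -(c * ∑ k, |x / (x + s k)|) ≤ c * ∑ k, x / (x + s k) := by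
    rw [← mul_neg, ← Finset.sum_neg_distrib]
    exact mul_le_mul_of_nonneg_left (Finset.sum_le_sum fun k _ => neg_abs_le _) hc
  have h6 := mul_mpInv (c := c) hreg
  have hB : -x * mpInv c s x ≤ 1 + (τ⁻¹ + 1) / 2 := by linarith
  rw [le_div_iff₀ (by positivity)]
  rcases le_or_gt (mpInv c s x) 0 with h7 | h7
  · have : 0 < τ⁻¹ := inv_pos.2 hτ
    nlinarith [sq_nonneg τ]
  · nlinarith

end Edges

/-! ### Enumeration of the critical points -/

section Enumeration

/-- `xc 1 ≥ ⋯ ≥ xc (2q - 1)` enumerate with multiplicity the zeros of `g` in `J 1 ∪ ⋯ ∪ J n`. -/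
structure IsZeroEnum (g g' : ℝ → ℝ) (J : ℕ → Set ℝ) (x₁ : ℝ) (n q : ℕ) (xc : ℕ → ℝ) : Prop where
  one_le : 1 ≤ q
  first : xc 1 = x₁
  anti : ∀ k l, 1 ≤ k → k ≤ l → l ≤ 2 * q - 1 → xc l ≤ xc k
  mem : ∀ k, 1 ≤ k → k ≤ 2 * q - 1 → (∃ i, 1 ≤ i ∧ i ≤ n ∧ xc k ∈ J i) ∧ g (xc k) = 0
  surj : ∀ y, (∃ i, 1 ≤ i ∧ i ≤ n ∧ y ∈ J i) → g y = 0 → ∃ k, 1 ≤ k ∧ k ≤ 2 * q - 1 ∧ xc k = y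
  mult : ∀ k l, 1 ≤ k → k ≤ 2 * q - 1 → 1 ≤ l → l ≤ 2 * q - 1 → k ≠ l →
    xc k ≠ xc l ∨ g' (xc k) = 0
  pair : ∀ k, 1 ≤ k → k < q →
    ∃ i, 2 ≤ i ∧ i ≤ n ∧ IsZeroPair g g' (J i) (xc (2 * k + 1)) (xc (2 * k))
  pos : ∀ w, (∃ i, 1 ≤ i ∧ i ≤ n ∧ w ∈ J i) → 0 < g w →
    x₁ < w ∨ ∃ k, 1 ≤ k ∧ k < q ∧ xc (2 * k + 1) < w ∧ w < xc (2 * k)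

lemma IsZeroEnum.succ_of_neg {g g' : ℝ → ℝ} {J : ℕ → Set ℝ} {x₁ : ℝ} {n q : ℕ} {xc : ℕ → ℝ}
    (h : IsZeroEnum g g' J x₁ n q xc) (hneg : ∀ x ∈ J (n + 1), g x < 0) :
    IsZeroEnum g g' J x₁ (n + 1) q xc where
  one_le := h.one_le
  first := h.first
  anti := h.anti
  mem k h1 h2 := by
    obtain ⟨⟨i, hi1, hi2, hi3⟩, hg⟩ := h.mem k h1 h2
    exact ⟨⟨i, hi1, by omega, hi3⟩, hg⟩
  surj := by
    rintro y ⟨i, hi1, hi2, hy⟩ hg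
    rcases hi2.lt_or_eq with hi | rfl
    · exact h.surj y ⟨i, hi1, by omega, hy⟩ hg
    · exact absurd hg (hneg y hy).ne
  mult := h.mult
  pair k h1 h2 := by
    obtain ⟨i, hi1, hi2, hi3⟩ := h.pair k h1 h2
    exact ⟨i, hi1, by omega, hi3⟩
  pos := by
    rintro w ⟨i, hi1, hi2, hw⟩ hg
    rcases hi2.lt_or_eq with hi | rfl
    · exact h.pos w ⟨i, hi1, by omega, hw⟩ hg
    · exact absurd hg (hneg w hw).not_gt

lemma IsZeroEnum.succ_of_pair {g g' : ℝ → ℝ} {J : ℕ → Set ℝ} {x₁ lo hi : ℝ} {n q : ℕ}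
    {xc : ℕ → ℝ} (h : IsZeroEnum g g' J x₁ n q xc) (hn : 1 ≤ n)
    (hord : ∀ i, 1 ≤ i → i ≤ n → ∀ x ∈ J i, ∀ y ∈ J (n + 1), y < x)
    (hp : IsZeroPair g g' (J (n + 1)) lo hi) :
    IsZeroEnum g g' J x₁ (n + 1) (q + 1)
      (fun k => if k = 2 * q then hi else if k = 2 * q + 1 then lo else xc k) := by
  have hq := h.one_le
  set xc' : ℕ → ℝ := fun k => if k = 2 * q then hi else if k = 2 * q + 1 then lo else xc k
    with hxc'
  have hold : ∀ k, k ≤ 2 * q - 1 → xc' k = xc k := fun k hk => by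
    simp only [hxc']
    rw [if_neg (by omega), if_neg (by omega)]
  have hhi : xc' (2 * q) = hi := by simp [hxc']
  have hlo : xc' (2 * q + 1) = lo := by simp [hxc']
  have hcases : ∀ k, k ≤ 2 * (q + 1) - 1 → k ≤ 2 * q - 1 ∨ k = 2 * q ∨ k = 2 * q + 1 := by
    omega
  have hbelow : ∀ k, 1 ≤ k → k ≤ 2 * q - 1 → ∀ y ∈ J (n + 1), y < xc k := fun k h1 h2 y hy => by
    obtain ⟨⟨i, hi1, hi2, hi3⟩, -⟩ := h.mem k h1 h2
    exact hord i hi1 hi2 _ hi3 y hy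
  have hdeg : ∀ x y, (x = lo ∧ y = hi ∨ x = hi ∧ y = lo) → x ≠ y ∨ g' x = 0 := fun x y hxy => by
    by_cases he : lo = hi
    · right
      rcases hxy with ⟨rfl, -⟩ | ⟨rfl, -⟩
      · exact hp.deriv_eq_zero he
      · rw [← he]; exact hp.deriv_eq_zero he
    · left
      rcases hxy with ⟨rfl, rfl⟩ | ⟨rfl, rfl⟩
      · exact he
      · exact fun h => he h.symm
  refine ⟨by omega, (hold 1 (by omega)).trans h.first, ?_, ?_, ?_, ?_, ?_, ?_⟩
  · intro k l hk hkl hl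
    rcases hcases l hl with h1 | rfl | rfl
    · rw [hold l h1, hold k (by omega)]
      exact h.anti k l hk hkl h1
    · rcases hcases k (by omega) with h2 | rfl | rfl
      · rw [hold k h2, hhi]
        exact (hbelow k hk h2 _ hp.hi_mem).le
      · exact le_rfl
      · omega
    · rcases hcases k (by omega) with h2 | rfl | rfl
      · rw [hold k h2, hlo]
        exact (hbelow k hk h2 _ hp.lo_mem).le
      · rw [hhi, hlo]; exact hp.le
      · exact le_rfl
  · intro k hk hk2
    rcases hcases k hk2 with h1 | rfl | rfl
    · rw [hold k h1]
      obtain ⟨⟨i, hi1, hi2, hi3⟩, hg⟩ := h.mem k hk h1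
      exact ⟨⟨i, hi1, by omega, hi3⟩, hg⟩
    · rw [hhi]; exact ⟨⟨n + 1, by omega, le_rfl, hp.hi_mem⟩, hp.hi_zero⟩
    · rw [hlo]; exact ⟨⟨n + 1, by omega, le_rfl, hp.lo_mem⟩, hp.lo_zero⟩
  · rintro y ⟨i, hi1, hi2, hy⟩ hg
    rcases hi2.lt_or_eq with hi' | rfl
    · obtain ⟨k, hk1, hk2, hk3⟩ := h.surj y ⟨i, hi1, by omega, hy⟩ hg
      exact ⟨k, hk1, by omega, by rw [hold k hk2, hk3]⟩
    · rcases hp.eq_or_eq y hy hg with rfl | rfl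
      · exact ⟨2 * q + 1, by omega, by omega, hlo⟩
      · exact ⟨2 * q, by omega, by omega, hhi⟩
  · intro k l hk hk2 hl hl2 hkl
    rcases hcases k hk2 with h1 | h1 | h1 <;> rcases hcases l hl2 with h2 | h2 | h2
    · rw [hold k h1, hold l h2]
      exact h.mult k l hk h1 hl h2 hkl
    · rw [hold k h1, h2, hhi]
      exact Or.inl (hbelow k hk h1 _ hp.hi_mem).ne'
    · rw [hold k h1, h2, hlo]
      exact Or.inl (hbelow k hk h1 _ hp.lo_mem).ne'
    · rw [hold l h2, h1, hhi]
      exact Or.inl (hbelow l hl h2 _ hp.hi_mem).ne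
    · omega
    · rw [h1, h2, hhi, hlo]
      exact hdeg _ _ (Or.inr ⟨rfl, rfl⟩)
    · rw [hold l h2, h1, hlo]
      exact Or.inl (hbelow l hl h2 _ hp.lo_mem).ne
    · rw [h1, h2, hhi, hlo]
      exact hdeg _ _ (Or.inl ⟨rfl, rfl⟩)
    · omega
  · intro k hk hkq
    rcases Nat.lt_succ_iff_lt_or_eq.1 hkq with h1 | rfl
    · obtain ⟨i, hi1, hi2, hi3⟩ := h.pair k hk h1
      rw [hold _ (by omega), hold _ (by omega)]
      exact ⟨i, hi1, by omega, hi3⟩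
    · rw [hhi, hlo]
      exact ⟨n + 1, by omega, le_rfl, hp⟩
  · rintro w ⟨i, hi1, hi2, hw⟩ hg
    rcases hi2.lt_or_eq with hi' | rfl
    · rcases h.pos w ⟨i, hi1, by omega, hw⟩ hg with h1 | ⟨k, hk1, hk2, hk3⟩
      · exact Or.inl h1
      · refine Or.inr ⟨k, hk1, by omega, ?_⟩
        rwa [hold _ (by omega), hold _ (by omega)]
    · refine Or.inr ⟨q, hq, by omega, ?_⟩
      rw [hhi, hlo]
      exact (hp.pos_iff w hw).1 hg

lemma exists_isZeroEnum {g g' : ℝ → ℝ} {J : ℕ → Set ℝ} {x₁ : ℝ} {M : ℕ} (hM : 1 ≤ M)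
    (hx₁ : x₁ ∈ J 1) (hg₁ : g x₁ = 0) (huniq : ∀ y ∈ J 1, g y = 0 → y = x₁)
    (hpos : ∀ y ∈ J 1, 0 < g y ↔ x₁ < y)
    (hord : ∀ i j, 1 ≤ i → i < j → j ≤ M → ∀ x ∈ J i, ∀ y ∈ J j, y < x)
    (hpair : ∀ i, 2 ≤ i → i ≤ M → (∀ x ∈ J i, g x < 0) ∨ ∃ lo hi, IsZeroPair g g' (J i) lo hi) :
    ∃ q xc, IsZeroEnum g g' J x₁ M q xc := by
  suffices H : ∀ n, 1 ≤ n → n ≤ M → ∃ q xc, IsZeroEnum g g' J x₁ n q xc from H M hM le_rfl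
  intro n hn
  induction n, hn using Nat.le_induction with
  | base =>
    refine fun _ => ⟨1, fun _ => x₁, le_rfl, rfl, fun _ _ _ _ _ => le_rfl,
      fun _ _ _ => ⟨⟨1, le_rfl, le_rfl, hx₁⟩, hg₁⟩, ?_, by omega, by omega, ?_⟩
    · rintro y ⟨i, hi1, hi2, hy⟩ hg
      obtain rfl : i = 1 := by omega
      exact ⟨1, le_rfl, le_rfl, (huniq y hy hg).symm⟩
    · rintro w ⟨i, hi1, hi2, hw⟩ hg
      obtain rfl : i = 1 := by omega
      exact Or.inl ((hpos w hw).1 hg)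
  | succ n hn ih =>
    intro hnM
    obtain ⟨q, xc, h⟩ := ih (by omega)
    rcases hpair (n + 1) (by omega) hnM with hneg | ⟨lo, hi, hp⟩
    · exact ⟨q, xc, h.succ_of_neg hneg⟩
    · exact ⟨q + 1, _, h.succ_of_pair hn
        (fun i hi1 hi2 => hord i (n + 1) hi1 (by omega) hnM) hp⟩

end Enumeration

/-! ### Values attained with positive slope -/

section EdgeIntervals

variable {ι : Type*} [Fintype ι] {c : ℝ} {s : ι → ℝ}

/-- The values `t > 0` not attained by `mpInv` with positive slope are those lying in one of the
intervals between consecutive edges. -/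
lemma IsZeroEnum.not_exists_iff {J : ℕ → Set ℝ} {x₁ : ℝ} {n q : ℕ} {xc a : ℕ → ℝ} {i₁ iₙ : ι}
    (h : IsZeroEnum (mpSlope c s) (mpSlopeDeriv c s) J x₁ n q xc) (hc : 0 ≤ c)
    (hmin : ∀ k, s i₁ ≤ s k) (hx₁ : x₁ ∈ Set.Ioo (-s i₁) 0)
    (hfirst : ∀ y ∈ Set.Ioo (-s i₁) 0, x₁ < y → 0 < mpSlope c s y)
    (hreg : ∀ i, 1 ≤ i → i ≤ n → ∀ w ∈ J i, MPRegular s w ∧ w < 0)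
    (hconn : ∀ i, (J i).OrdConnected)
    (hcover : ∀ w, MPRegular s w → (w < -s iₙ ∨ 0 < w) ∨ ∃ i, 1 ≤ i ∧ i ≤ n ∧ w ∈ J i)
    (ha : ∀ k, 1 ≤ k → k ≤ 2 * q - 1 → a k = mpInv c s (xc k))
    (hanti : ∀ k l, 1 ≤ k → k ≤ l → l ≤ 2 * q → a l ≤ a k)
    (hlast : ∀ t, 0 < t → t < a (2 * q) →
      ∃ w, MPRegular s w ∧ 0 < mpSlope c s w ∧ mpInv c s w = t)
    (hlast_lt : ∀ w, w < -s iₙ ∨ 0 < w → 0 < mpSlope c s w → 0 < mpInv c s w →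
      mpInv c s w < a (2 * q))
    {t : ℝ} (ht : 0 < t) :
    (¬ ∃ w, MPRegular s w ∧ 0 < mpSlope c s w ∧ mpInv c s w = t) ↔
      ∃ k, 1 ≤ k ∧ k ≤ q ∧ a (2 * k) ≤ t ∧ t ≤ a (2 * k - 1) := by
  have hq := h.one_le
  have hxc : ∀ k, 1 ≤ k → k ≤ 2 * q - 1 →
      MPRegular s (xc k) ∧ xc k < 0 ∧ mpSlope c s (xc k) = 0 := fun k h1 h2 => by
    obtain ⟨⟨i, hi1, hi2, hi3⟩, hg⟩ := h.mem k h1 h2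
    exact ⟨(hreg i hi1 hi2 _ hi3).1, (hreg i hi1 hi2 _ hi3).2, hg⟩
  constructor
  · intro hno
    by_contra! hout
    have hstep : ∀ k, 1 ≤ k → k ≤ q → t ≤ a (2 * k - 1) := by
      intro k hk
      induction k, hk using Nat.le_induction with
      | base =>
        intro _
        by_contra! hlt
        rw [ha 1 le_rfl (by omega), h.first] at hlt
        exact hno (exists_of_first_edge_lt hc hmin hx₁ ht hlt hfirst)
      | succ k hk ih =>
        intro hkq
        by_contra! hlt
        have hlt' : t < a (2 * k) := by
          by_contra! hge
          exact (hout k hk (by omega) hge).not_ge (ih (by omega))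
        rw [show 2 * (k + 1) - 1 = 2 * k + 1 by omega, ha _ (by omega) (by omega)] at hlt
        rw [ha _ (by omega) (by omega)] at hlt'
        obtain ⟨i, hi1, hi2, hp⟩ := h.pair k hk (by omega)
        have hsub := (hconn i).out hp.lo_mem hp.hi_mem
        obtain ⟨w, hw, hfw⟩ := intermediate_value_Ioo hp.le
          (fun u hu => (continuousAt_mpInv (c := c)
            (hreg i (by omega) hi2 u (hsub hu)).1).continuousWithinAt) ⟨hlt, hlt'⟩
        have hwJ := hsub (Set.Ioo_subset_Icc_self hw)
        exact hno ⟨w, (hreg i (by omega) hi2 w hwJ).1, (hp.pos_iff w hwJ).2 hw, hfw⟩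
    have hlt : t < a (2 * q) := by
      by_contra! hge
      exact (hout q hq le_rfl hge).not_ge (hstep q hq le_rfl)
    exact hno (hlast t ht hlt)
  · rintro ⟨k, hk1, hkq, hlo, hhi⟩ ⟨w, hw, hg, rfl⟩
    rcases hcover w hw with hw' | hw'
    · exact ((hlast_lt w hw' hg ht).trans_le
        (hanti (2 * k) (2 * q) (by omega) (by omega) le_rfl)).not_ge hlo
    · have hw0 : w < 0 := by
        obtain ⟨i, hi1, hi2, hi3⟩ := hw'
        exact (hreg i hi1 hi2 w hi3).2
      have hlt_of : ∀ j, 1 ≤ j → j ≤ 2 * q - 1 → xc j < w → a j < mpInv c s w :=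
        fun j h1 h2 hj => by
          obtain ⟨r, hneg, hz⟩ := hxc j h1 h2
          rw [ha j h1 h2]
          exact mpInv_lt_of_mul_pos hc r hw (by linarith) (mul_pos_of_neg_of_neg hneg hw0) hj
      have hgt_of : ∀ j, 1 ≤ j → j ≤ 2 * q - 1 → w < xc j → mpInv c s w < a j :=
        fun j h1 h2 hj => by
          obtain ⟨r, hneg, hz⟩ := hxc j h1 h2
          rw [ha j h1 h2]
          exact mpInv_lt_of_mul_pos hc hw r (by linarith) (mul_pos_of_neg_of_neg hw0 hneg) hj
      rcases h.pos w hw' hg with hfst | ⟨l, hl1, hlq, hl, hl'⟩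
      · have := hlt_of 1 le_rfl (by omega) (h.first ▸ hfst)
        linarith [hanti 1 (2 * k - 1) le_rfl (by omega) (by omega)]
      · have h1 := hlt_of (2 * l + 1) (by omega) (by omega) hl
        have h2 := hgt_of (2 * l) (by omega) (by omega) hl'
        rcases le_or_gt k l with hkl | hkl
        · linarith [hanti (2 * k) (2 * l) (by omega) (by omega) (by omega)]
        · linarith [hanti (2 * l + 1) (2 * k - 1) (by omega) (by omega) (by omega)]

end EdgeIntervals

/-! ### The intervals `I_i` -/

section Intervals

variable {M : ℕ} {σ : Fin M → ℝ}

lemma sigE_eq {i : ℕ} (h1 : 1 ≤ i) (h2 : i ≤ M) : sigE M σ i = σ ⟨i - 1, by omega⟩ :=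
  dif_pos ⟨h1, h2⟩

lemma intI_one (hM : 0 < M) : intI M σ 1 = Set.Ioo (-(σ ⟨0, hM⟩)⁻¹) 0 := by
  rw [intI, if_pos rfl, sigE_eq le_rfl hM]

lemma intI_of_two_le {i : ℕ} (h1 : 2 ≤ i) (h2 : i ≤ M) :
    intI M σ i = Set.Ioo (-(σ ⟨i - 1, by omega⟩)⁻¹) (-(σ ⟨i - 2, by omega⟩)⁻¹) := by
  rw [intI, if_neg (by omega), sigE_eq (by omega) h2, sigE_eq (by omega) (by omega)]
  rfl

lemma mem_intI0 (hM : 0 < M) {x : ℝ} :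
    x ∈ intI0 M σ ↔ x < -(σ ⟨M - 1, by omega⟩)⁻¹ ∨ 0 < x := by
  rw [intI0, sigE_eq hM le_rfl]
  rfl

lemma ordConnected_intI (i : ℕ) : (intI M σ i).OrdConnected := by
  unfold intI
  split_ifs <;> exact Set.ordConnected_Ioo

lemma lt_of_mem_intI (hσ : Monotone fun i => (σ i)⁻¹) {i : ℕ} (h1 : 1 ≤ i) (h2 : i ≤ M) {x : ℝ}
    (hx : x ∈ intI M σ i) :
    -(σ ⟨i - 1, by omega⟩)⁻¹ < x ∧ ∀ k : Fin M, (k : ℕ) + 1 < i → x < -(σ k)⁻¹ := by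
  rcases h1.eq_or_lt with rfl | h1'
  · rw [intI_one h2] at hx
    exact ⟨hx.1, fun k hk => by omega⟩
  · rw [intI_of_two_le h1' h2] at hx
    refine ⟨hx.1, fun k hk => hx.2.trans_le (neg_le_neg (hσ ?_))⟩
    rw [Fin.le_def]
    simp only
    omega

lemma mpRegular_of_mem_intI (hσ : Monotone fun i => (σ i)⁻¹) (hpos : ∀ i, 0 < (σ i)⁻¹) {i : ℕ}
    (h1 : 1 ≤ i) (h2 : i ≤ M) {x : ℝ} (hx : x ∈ intI M σ i) :
    MPRegular (fun i => (σ i)⁻¹) x ∧ x < 0 := by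
  obtain ⟨hlo, hhi⟩ := lt_of_mem_intI hσ h1 h2 hx
  have hx0 : x < 0 := by
    rcases h1.eq_or_lt with rfl | h1'
    · rw [intI_one h2] at hx
      exact hx.2
    · exact (hhi ⟨0, by omega⟩ (by simpa using h1')).trans (neg_lt_zero.2 (hpos _))
  refine ⟨⟨hx0.ne, fun k => ?_⟩, hx0⟩
  rcases lt_or_ge ((k : ℕ) + 1) i with hk | hk
  · have := hhi k hk
    exact (show x + (σ k)⁻¹ < 0 by linarith).ne
  · have : (σ ⟨i - 1, by omega⟩)⁻¹ ≤ (σ k)⁻¹ := hσ (by rw [Fin.le_def]; simp only; omega)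
    exact (show 0 < x + (σ k)⁻¹ by linarith).ne'

lemma neg_last_lt_of_mem_intI (hσ : Monotone fun i => (σ i)⁻¹) {i : ℕ} (h1 : 1 ≤ i) (h2 : i ≤ M)
    {x : ℝ} (hx : x ∈ intI M σ i) : -(σ ⟨M - 1, by omega⟩)⁻¹ < x := by
  refine lt_of_le_of_lt (neg_le_neg (hσ ?_)) (lt_of_mem_intI hσ h1 h2 hx).1
  rw [Fin.le_def]
  simp only
  omega

lemma lt_of_mem_intI_of_lt (hσ : Monotone fun i => (σ i)⁻¹) {i j : ℕ} (hi : 1 ≤ i) (hij : i < j)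
    (hj : j ≤ M) {x y : ℝ} (hx : x ∈ intI M σ i) (hy : y ∈ intI M σ j) : y < x :=
  ((lt_of_mem_intI hσ (by omega) hj hy).2 ⟨i - 1, by omega⟩ (by simp only; omega)).trans
    (lt_of_mem_intI hσ hi (by omega) hx).1

lemma mpRegular_of_mem_intI0 (hM : 0 < M) (hσ : Monotone fun i => (σ i)⁻¹)
    (hpos : ∀ i, 0 < (σ i)⁻¹) {x : ℝ} (hx : x ∈ intI0 M σ) :
    MPRegular (fun i => (σ i)⁻¹) x := by
  rcases (mem_intI0 hM).1 hx with hx | hx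
  · refine ⟨by linarith [hpos ⟨M - 1, by omega⟩], fun k => ?_⟩
    have : (σ k)⁻¹ ≤ (σ ⟨M - 1, by omega⟩)⁻¹ := hσ (by rw [Fin.le_def]; simp only; omega)
    exact (show x + (σ k)⁻¹ < 0 by linarith).ne
  · exact MPRegular.of_pos hpos hx

lemma mem_intI0_or_exists_mem_intI (hM : 0 < M) {x : ℝ} (hx : MPRegular (fun i => (σ i)⁻¹) x) :
    (x < -(σ ⟨M - 1, by omega⟩)⁻¹ ∨ 0 < x) ∨ ∃ i, 1 ≤ i ∧ i ≤ M ∧ x ∈ intI M σ i := by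
  classical
  by_cases hx0 : 0 < x
  · exact .inl (.inr hx0)
  by_cases hlast : x < -(σ ⟨M - 1, by omega⟩)⁻¹
  · exact .inl (.inl hlast)
  have hne : ∀ k, x ≠ -(σ k)⁻¹ := fun k hk => hx.2 k (by simp [hk])
  have hex : ∃ k, ∃ h : k < M, -(σ ⟨k, h⟩)⁻¹ < x :=
    ⟨M - 1, by omega, lt_of_le_of_ne (not_lt.1 hlast) (hne _).symm⟩
  obtain ⟨hkM, hk⟩ := Nat.find_spec hex
  have hlt := fun j (hj : j < Nat.find hex) => Nat.find_min hex hj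
  generalize Nat.find hex = k at hkM hk hlt
  refine .inr ⟨k + 1, by omega, hkM, ?_⟩
  rcases Nat.eq_zero_or_pos k with rfl | hk0
  · rw [zero_add, intI_one hM]
    exact ⟨hk, lt_of_le_of_ne (not_lt.1 hx0) hx.1⟩
  · rw [intI_of_two_le (by omega) hkM]
    refine ⟨hk, lt_of_le_of_ne (not_lt.1 fun h => hlt (k - 1) (by omega) ⟨by omega, h⟩) (hne _)⟩

end Intervals
/-- **Lemma 1.2 (Structure of the deformed Marchenko–Pastur density).**
`f` is smooth on each of the intervals `I_0, I_1, …, I_M`; counting with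
multiplicity (degenerate critical points counted twice, and `∞` being the
nondegenerate critical point in `I_0` when `N = M`), there is exactly one
critical point in each of `I_0` and `I_1` and zero or two in each `I_i`,
`2 ≤ i ≤ M`; the critical values `a_k = f(x_k)` are ordered, nonnegative and
bounded by a constant `C` depending only on `τ`, satisfy `x_k = m(a_k)`
(as a boundary value, with `m(0) = ∞` when `N = M`), and the support of `ρ`
on `(0,∞)` is `⋃_{k=1}^p [a_{2k}, a_{2k-1}] ∩ (0,∞)`. -/
theorem deformed_MP_density_structure (τ : ℝ) (hτ : 0 < τ) :
    ∃ C : ℝ, 0 < C ∧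
    ∀ (N M : ℕ), 0 < M → 0 < N →
      τ ≤ (N : ℝ) / M → (N : ℝ) / M ≤ τ⁻¹ →
      ∀ σ : Fin M → ℝ,
        (∀ i j : Fin M, i ≤ j → σ j ≤ σ i) →
        (∀ i, τ < σ i) → (∀ i, σ i ≤ τ⁻¹) →
      ∀ m : ℂ → ℂ,
        (∀ z : ℂ, 0 < z.im → 0 < (m z).im) →
        (∀ z : ℂ, 0 < z.im →
          (m z)⁻¹ = -z + ((N : ℂ))⁻¹ * ∑ i, (σ i : ℂ) / (1 + m z * (σ i : ℂ))) →
        (∀ z : ℂ, 0 < z.im → ∀ w : ℂ, 0 < w.im →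
          w⁻¹ = -z + ((N : ℂ))⁻¹ * ∑ i, (σ i : ℂ) / (1 + w * (σ i : ℂ)) → w = m z) →
      ∀ ρ : Measure ℝ, IsProbabilityMeasure ρ →
        (∀ z : ℂ, 0 < z.im → m z = ∫ x, ((x : ℂ) - z)⁻¹ ∂ρ) →
      ∀ f : ℝ → ℝ, f = fMP N M σ →
      -- (Smoothness) `f` is smooth on each of the open intervals
      (∀ i, 1 ≤ i → i ≤ M → ContDiffOn ℝ (⊤ : ℕ∞) f (intI M σ i)) ∧
      ContDiffOn ℝ (⊤ : ℕ∞) f (intI0 M σ) ∧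
      -- (Critical points) exactly one (nondegenerate) critical point in `I_1`
      (∃ x ∈ intI M σ 1, deriv f x = 0 ∧ deriv (deriv f) x ≠ 0 ∧
        ∀ y ∈ intI M σ 1, deriv f y = 0 → y = x) ∧
      -- zero or two (with multiplicity) in each `I_i`, `2 ≤ i ≤ M`
      (∀ i, 2 ≤ i → i ≤ M →
        (∀ x ∈ intI M σ i, deriv f x ≠ 0) ∨
        (∃ x ∈ intI M σ i, ∃ y ∈ intI M σ i, x ≠ y ∧
          deriv f x = 0 ∧ deriv f y = 0 ∧
          deriv (deriv f) x ≠ 0 ∧ deriv (deriv f) y ≠ 0 ∧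
          ∀ w ∈ intI M σ i, deriv f w = 0 → w = x ∨ w = y) ∨
        (∃ x ∈ intI M σ i, deriv f x = 0 ∧ deriv (deriv f) x = 0 ∧
          ∀ w ∈ intI M σ i, deriv f w = 0 → w = x)) ∧
      -- exactly one in `I_0`: a nondegenerate real one if `N ≠ M`, and `∞` if `N = M`
      ((N ≠ M → ∃ x ∈ intI0 M σ, deriv f x = 0 ∧ deriv (deriv f) x ≠ 0 ∧
          ∀ y ∈ intI0 M σ, deriv f y = 0 → y = x) ∧
        (N = M → ∀ x ∈ intI0 M σ, deriv f x ≠ 0)) ∧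
      -- (Ordering and structure of ρ)
      (∃ (p : ℕ) (xc a : ℕ → ℝ), 1 ≤ p ∧
        -- `x_1 ≥ ⋯ ≥ x_{2p-1}` enumerate (with multiplicity) the critical points
        -- of `f` in `I_1 ∪ ⋯ ∪ I_M`, and `x_{2p}` is the one in `I_0` (when real)
        (∀ k l, 1 ≤ k → k ≤ l → l ≤ 2 * p - 1 → xc l ≤ xc k) ∧
        (∀ k, 1 ≤ k → k ≤ 2 * p - 1 →
          (∃ i, 1 ≤ i ∧ i ≤ M ∧ xc k ∈ intI M σ i) ∧ deriv f (xc k) = 0) ∧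
        (∀ y, (∃ i, 1 ≤ i ∧ i ≤ M ∧ y ∈ intI M σ i) → deriv f y = 0 →
          ∃ k, 1 ≤ k ∧ k ≤ 2 * p - 1 ∧ xc k = y) ∧
        (∀ k l, 1 ≤ k → k ≤ 2 * p - 1 → 1 ≤ l → l ≤ 2 * p - 1 → k ≠ l →
          xc k ≠ xc l ∨ deriv (deriv f) (xc k) = 0) ∧
        (N ≠ M → xc (2 * p) ∈ intI0 M σ ∧ deriv f (xc (2 * p)) = 0) ∧
        -- the edges `a_k = f(x_k)` (with `a_{2p} = f(∞) = 0` when `N = M`)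
        (∀ k, 1 ≤ k → k ≤ 2 * p → (k ≤ 2 * p - 1 ∨ N ≠ M) → a k = f (xc k)) ∧
        (N = M → a (2 * p) = 0) ∧
        (∀ k l, 1 ≤ k → k ≤ l → l ≤ 2 * p → a l ≤ a k) ∧
        (∀ k, 1 ≤ k → k ≤ 2 * p → 0 ≤ a k ∧ a k ≤ C) ∧
        -- `x_k = m(a_k)` as a boundary value of the Stieltjes transform
        (∀ k, 1 ≤ k → k ≤ 2 * p → (k ≤ 2 * p - 1 ∨ N ≠ M) →
          Tendsto (fun η : ℝ => m ((a k : ℂ) + η * Complex.I)) (nhdsWithin 0 (Set.Ioi 0))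
            (nhds ((xc k : ℝ) : ℂ))) ∧
        -- (Structure of ρ): `supp ρ ∩ (0,∞) = (⋃_k [a_{2k}, a_{2k-1}]) ∩ (0,∞)`
        (∀ x : ℝ, 0 < x →
          ((∀ ε > (0:ℝ), 0 < ρ (Set.Ioo (x - ε) (x + ε))) ↔
            ∃ k, 1 ≤ k ∧ k ≤ p ∧ a (2 * k) ≤ x ∧ x ≤ a (2 * k - 1)))) := by
  refine ⟨(1 + (τ⁻¹ + 1) / 2) / (τ ^ 2 / 2), by positivity, ?_⟩
  intro N M hM hN hr hr' σ hσ hστ hστ' m him hm _ ρ hρp hρ f hf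
  set s : Fin M → ℝ := fun i => (σ i)⁻¹ with hs_def
  set c : ℝ := (N : ℝ)⁻¹ with hc_def
  replace hf : f = mpInv c s := hf
  subst hf
  have : Nonempty (Fin M) := ⟨⟨0, hM⟩⟩
  have hNpos : (0 : ℝ) < N := Nat.cast_pos.2 hN
  have hMpos : (0 : ℝ) < M := Nat.cast_pos.2 hM
  have hc : 0 < c := inv_pos.2 hNpos
  have hσpos : ∀ i, 0 < σ i := fun i => hτ.trans (hστ i)
  have hs : ∀ i, 0 < s i := fun i => inv_pos.2 (hσpos i)
  have hmono : Monotone s := fun i j hij => inv_anti₀ (hσpos j) (hσ i j hij)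
  have hτs : ∀ i, τ ≤ s i := fun i => (le_inv_comm₀ hτ (hσpos i)).2 (hστ' i)
  have hτ1 : τ ≤ 1 := by
    have h := hr.trans hr'
    rw [le_inv_comm₀ hτ hτ] at h
    by_contra! h1
    linarith [inv_lt_one_of_one_lt₀ h1]
  have hcard_eq : c * Fintype.card (Fin M) = M / N := by
    rw [Fintype.card_fin, hc_def, inv_mul_eq_div]
  have hcard : c * Fintype.card (Fin M) ≤ τ⁻¹ := by
    rw [hcard_eq, ← inv_div]
    exact inv_anti₀ hτ hr
  have hcard_one : c * Fintype.card (Fin M) = 1 ↔ N = M := by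
    rw [hcard_eq, div_eq_one_iff_eq hNpos.ne', Nat.cast_inj, eq_comm]
  have hmp : MPTransform c s m := by
    refine ⟨him, fun z hz => ?_⟩
    rw [hm z hz]
    have hterm : ∀ i, (σ i : ℂ) / (1 + m z * σ i) = (m z + (s i : ℝ))⁻¹ := fun i => by
      have h0 : (σ i : ℂ) ≠ 0 := Complex.ofReal_ne_zero.2 (hσpos i).ne'
      rw [hs_def, Complex.ofReal_inv, ← inv_div, add_div, mul_div_cancel_right₀ _ h0, one_div,
        add_comm]
    simp only [hterm, hc_def, Complex.ofReal_inv, Complex.ofReal_natCast]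
    ring
  have hmin : ∀ k, s ⟨0, hM⟩ ≤ s k := fun k => hmono (Fin.le_def.2 (Nat.zero_le _))
  have hmax : ∀ k, s k ≤ s ⟨M - 1, by omega⟩ := fun k =>
    hmono (by rw [Fin.le_def]; simp only; omega)
  have hreg : ∀ i, 1 ≤ i → i ≤ M → ∀ x ∈ intI M σ i, MPRegular s x ∧ x < 0 :=
    fun i h1 h2 x hx => mpRegular_of_mem_intI hmono hs h1 h2 hx
  have hreg0 : ∀ x ∈ intI0 M σ, MPRegular s x := fun x hx => mpRegular_of_mem_intI0 hM hmono hs hx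
  have hI1 : intI M σ 1 = Set.Ioo (-s ⟨0, hM⟩) 0 := intI_one hM
  have hgap : ∀ i, 2 ≤ i → i ≤ M → (∀ x ∈ intI M σ i, mpSlope c s x < 0) ∨
      ∃ lo hi, IsZeroPair (mpSlope c s) (mpSlopeDeriv c s) (intI M σ i) lo hi := by
    intro i h1 h2
    rw [intI_of_two_le h1 h2]
    refine mpSlope_gap hc hs (i := ⟨i - 1, by omega⟩) (j := ⟨i - 2, by omega⟩) fun k => ?_
    rcases le_or_gt ((k : ℕ) + 2) i with hk | hk
    · exact .inl (hmono (by rw [Fin.le_def]; simp only; omega))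
    · exact .inr (hmono (by rw [Fin.le_def]; simp only; omega))
  obtain ⟨x₁, hx₁, hgx₁, huniq, hpos⟩ := mpSlope_first hc hs hmin
  obtain ⟨q, xc, henum⟩ := exists_isZeroEnum (J := intI M σ) hM (hI1 ▸ hx₁) hgx₁
    (hI1 ▸ huniq) (hI1 ▸ hpos)
    (fun i j hi hij hj x hx y hy => lt_of_mem_intI_of_lt hmono hi hij hj hx hy) hgap
  obtain ⟨xl, al, hxl, hal, hal0, hal_le, hxl_uniq, hal_ex, hal_lt⟩ := exists_last_edge hc hs hmax
  refine ⟨fun i h1 h2 x hx => (contDiffAt_mpInv (hreg i h1 h2 x hx).1).contDiffWithinAt,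
    fun x hx => (contDiffAt_mpInv (hreg0 x hx)).contDiffWithinAt, ?_, ?_, ⟨?_, ?_⟩, ?_⟩
  · have hr1 := fun y hy => (hreg 1 le_rfl hM y hy).1
    rw [hI1] at hr1 ⊢
    refine ⟨x₁, hx₁, (deriv_mpInv_eq_zero_iff (hr1 x₁ hx₁)).2 hgx₁, ?_, fun y hy h0 =>
      huniq y hy ((deriv_mpInv_eq_zero_iff (hr1 y hy)).1 h0)⟩
    rw [Ne, deriv_deriv_mpInv_eq_zero_iff (hr1 x₁ hx₁) hgx₁]
    exact (mpSlopeDeriv_pos_of_neg hc hs hx₁.2 fun i => by linarith [hmin i, hx₁.1]).ne'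
  · intro i h1 h2
    have hri := fun y hy => (hreg i (by omega) h2 y hy).1
    rcases hgap i h1 h2 with hneg | ⟨lo, hi, hp⟩
    · exact .inl fun x hx h0 => (hneg x hx).ne ((deriv_mpInv_eq_zero_iff (hri x hx)).1 h0)
    · right
      have hlo := (deriv_mpInv_eq_zero_iff (hri lo hp.lo_mem)).2 hp.lo_zero
      have hhi := (deriv_mpInv_eq_zero_iff (hri hi hp.hi_mem)).2 hp.hi_zero
      have hor : ∀ w ∈ intI M σ i, deriv (mpInv c s) w = 0 → w = lo ∨ w = hi := fun w hw h0 =>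
        hp.eq_or_eq w hw ((deriv_mpInv_eq_zero_iff (hri w hw)).1 h0)
      rcases hp.le.eq_or_lt with heq | hlt
      · refine .inr ⟨lo, hp.lo_mem, hlo, ?_, fun w hw h0 => (hor w hw h0).elim id (·.trans heq.symm)⟩
        exact (deriv_deriv_mpInv_eq_zero_iff (hri lo hp.lo_mem) hp.lo_zero).2 (hp.deriv_eq_zero heq)
      · obtain ⟨hd, hd'⟩ := hp.deriv_ne_zero hlt
        exact .inl ⟨lo, hp.lo_mem, hi, hp.hi_mem, hlt.ne, hlo, hhi,
          mt (deriv_deriv_mpInv_eq_zero_iff (hri lo hp.lo_mem) hp.lo_zero).1 hd,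
          mt (deriv_deriv_mpInv_eq_zero_iff (hri hi hp.hi_mem) hp.hi_zero).1 hd', hor⟩
  · intro hNM
    obtain ⟨hmem, hgx, -⟩ := hxl (mt hcard_one.1 hNM)
    have hmem' : xl ∈ intI0 M σ := (mem_intI0 hM).2 hmem
    refine ⟨xl, hmem', (deriv_mpInv_eq_zero_iff (hreg0 xl hmem')).2 hgx, ?_, fun y hy h0 =>
      (hxl_uniq y ((mem_intI0 hM).1 hy) ((deriv_mpInv_eq_zero_iff (hreg0 y hy)).1 h0)).2⟩
    rw [Ne, deriv_deriv_mpInv_eq_zero_iff (hreg0 xl hmem') hgx]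
    rcases hmem with h | h
    · exact (mpSlopeDeriv_neg_of_lt hc hs fun i => by linarith [hmax i]).ne
    · exact (mpSlopeDeriv_neg_of_pos hc hs h).ne
  · intro hNM x hx h0
    exact (hxl_uniq x ((mem_intI0 hM).1 hx) ((deriv_mpInv_eq_zero_iff (hreg0 x hx)).1 h0)).1
      (hcard_one.2 hNM)
  have hq := henum.one_le
  have hxc : ∀ k, 1 ≤ k → k ≤ 2 * q - 1 →
      MPRegular s (xc k) ∧ xc k < 0 ∧ -s ⟨M - 1, by omega⟩ < xc k ∧ mpSlope c s (xc k) = 0 :=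
    fun k h1 h2 => by
      obtain ⟨⟨i, hi1, hi2, hi3⟩, hg⟩ := henum.mem k h1 h2
      exact ⟨(hreg i hi1 hi2 _ hi3).1, (hreg i hi1 hi2 _ hi3).2,
        neg_last_lt_of_mem_intI hmono hi1 hi2 hi3, hg⟩
  set xc' : ℕ → ℝ := fun k => if k = 2 * q then xl else xc k with hxc'
  set a : ℕ → ℝ := fun k => if k = 2 * q then al else mpInv c s (xc k) with ha
  have hxc'_of : ∀ k, 1 ≤ k → k ≤ 2 * q - 1 → xc' k = xc k := fun k h1 h2 => if_neg (by omega)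
  have ha_of : ∀ k, 1 ≤ k → k ≤ 2 * q - 1 → a k = mpInv c s (xc k) :=
    fun k h1 h2 => if_neg (by omega)
  have hxc'_last : xc' (2 * q) = xl := if_pos rfl
  have ha_last : a (2 * q) = al := if_pos rfl
  have hanti : ∀ k l, 1 ≤ k → k ≤ l → l ≤ 2 * q → a l ≤ a k := by
    intro k l hk hkl hl
    rcases hl.eq_or_lt with rfl | hl'
    · rcases hkl.eq_or_lt with rfl | hkl'
      · rfl
      · obtain ⟨r, hneg, hlow, hz⟩ := hxc k hk (by omega)
        rw [ha_last, ha_of k hk (by omega)]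
        exact hal_le _ r hlow hneg hz.ge
    · obtain ⟨r, hneg, -, hz⟩ := hxc k hk (by omega)
      obtain ⟨r', hneg', -, hz'⟩ := hxc l (by omega) (by omega)
      rw [ha_of k hk (by omega), ha_of l (by omega) (by omega)]
      exact mpInv_le_of_mul_pos hc.le r' r hz'.ge hz.ge (mul_pos_of_neg_of_neg hneg' hneg)
        (henum.anti k l hk hkl (by omega))
  have ha_first : a 1 ≤ (1 + (τ⁻¹ + 1) / 2) / (τ ^ 2 / 2) := by
    rw [ha_of 1 le_rfl (by omega), henum.first]
    exact mpInv_first_edge_le hc.le hmin hτ hτ1 (hτs _) hcard hx₁ hgx₁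
  have hedge : ∀ k, 1 ≤ k → k ≤ 2 * q → (k ≤ 2 * q - 1 ∨ N ≠ M) →
      MPRegular s (xc' k) ∧ mpSlope c s (xc' k) = 0 ∧ a k = mpInv c s (xc' k) := by
    intro k h1 h2 h3
    by_cases hk : k ≤ 2 * q - 1
    · obtain ⟨r, -, -, hz⟩ := hxc k h1 hk
      rw [hxc'_of k h1 hk]
      exact ⟨r, hz, ha_of k h1 hk⟩
    · obtain rfl : k = 2 * q := by omega
      obtain ⟨hmem, hgx, hax⟩ := hxl (mt hcard_one.1 (h3.resolve_left hk))
      rw [hxc'_last, ha_last]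
      exact ⟨hreg0 _ ((mem_intI0 hM).2 hmem), hgx, hax⟩
  refine ⟨q, xc', a, hq, ?_, ?_, ?_, ?_, ?_, fun k h1 h2 h3 => (hedge k h1 h2 h3).2.2, ?_, hanti,
    ?_, ?_, ?_⟩
  · intro k l hk hkl hl
    rw [hxc'_of k hk (by omega), hxc'_of l (by omega) hl]
    exact henum.anti k l hk hkl hl
  · intro k h1 h2
    rw [hxc'_of k h1 h2]
    exact ⟨(henum.mem k h1 h2).1, (deriv_mpInv_eq_zero_iff (hxc k h1 h2).1).2 (hxc k h1 h2).2.2.2⟩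
  · rintro y ⟨i, hi1, hi2, hi3⟩ h0
    obtain ⟨k, h1, h2, h3⟩ := henum.surj y ⟨i, hi1, hi2, hi3⟩
      ((deriv_mpInv_eq_zero_iff (hreg i hi1 hi2 y hi3).1).1 h0)
    exact ⟨k, h1, h2, (hxc'_of k h1 h2).trans h3⟩
  · intro k l hk hk' hl hl' hkl
    rw [hxc'_of k hk hk', hxc'_of l hl hl',
      deriv_deriv_mpInv_eq_zero_iff (hxc k hk hk').1 (hxc k hk hk').2.2.2]
    exact henum.mult k l hk hk' hl hl' hkl
  · intro hNM
    obtain ⟨r, hz, -⟩ := hedge (2 * q) (by omega) le_rfl (.inr hNM)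
    refine ⟨?_, (deriv_mpInv_eq_zero_iff r).2 hz⟩
    rw [hxc'_last]
    exact (mem_intI0 hM).2 (hxl (mt hcard_one.1 hNM)).1
  · intro hNM
    rw [ha_last]
    exact hal (hcard_one.2 hNM)
  · intro k h1 h2
    exact ⟨(hal0.trans ha_last.ge).trans (hanti k (2 * q) h1 h2 le_rfl),
      (hanti 1 k le_rfl h1 h2).trans ha_first⟩
  · intro k h1 h2 h3
    obtain ⟨r, hz, hak⟩ := hedge k h1 h2 h3
    rw [hak]
    exact (hmp.tendsto hc hs r hz.ge).comp (tendsto_add_mul_I _)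
  · intro x hx
    rw [hmp.measure_Ioo_pos_iff hρ hc hs x]
    exact henum.not_exists_iff hc.le hmin hx₁ (fun y hy h => (hpos y hy).2 h) hreg
      ordConnected_intI (fun w hw => mem_intI0_or_exists_mem_intI hM hw) ha_of hanti
      (ha_last ▸ hal_ex) (ha_last ▸ hal_lt) hx

end
end

section
/- Deterministic smoothing bound for the indicator of an interval (Lemma inside Appendix A): Let η̃ > 0, E^− ≤ E_U real numbers, 𝒳_E(x) := 1(E^− ≤ x ≤ E_U), and ϑ_{η̃}(y) := η̃/(π(y²+η̃²)). Set d(x) := |x−E^−|+η̃ and d_U(x) := |x−E_U|+η̃. Then there exists an absolute constant C>0 such that for all x ∈ ℝ: | 𝒳_E(x) − (𝒳_E ∗ ϑ_{η̃})(x) | ≤ C η̃ [ (E_U−E^−)/( d_U(x) d(x) ) + 𝒳_E(x)/( d_U(x)+d(x) ) ], where ∗ denotes convolution, i.e. (𝒳_E ∗ ϑ_{η̃})(x) = ∫_ℝ 𝒳_E(x−y) ϑ_{η̃}(y) dy. -/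
open MeasureTheory

noncomputable section

/-- The Cauchy (Poisson) kernel at scale `η̃ > 0`. -/
def cauchyKer (ηt y : ℝ) : ℝ := ηt / (Real.pi * (y ^ 2 + ηt ^ 2))

/-- The sharp indicator of the interval `[E⁻, E_U]`. -/
def sharpInd (Em EU x : ℝ) : ℝ := Set.indicator (Set.Icc Em EU) (fun _ => (1 : ℝ)) x

/-- The Cauchy-smoothed indicator `(𝒳_E ∗ ϑ_{η̃})(x) = ∫ 𝒳_E(x - y) ϑ_{η̃}(y) dy`. -/
def smoothInd (Em EU ηt x : ℝ) : ℝ := ∫ y, sharpInd Em EU (x - y) * cauchyKer ηt y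

lemma hasDerivAt_arctan_div_pi {η : ℝ} (hη : 0 < η) (y : ℝ) :
    HasDerivAt (fun y => Real.arctan (y / η) / Real.pi) (cauchyKer η y) y := by
  refine ((((hasDerivAt_id y).div_const η).arctan).div_const Real.pi).congr_deriv ?_
  have : 0 < y ^ 2 + η ^ 2 := by positivity
  simp only [cauchyKer, id]
  field_simp
  ring

lemma continuous_cauchyKer {η : ℝ} (hη : 0 < η) : Continuous (cauchyKer η) := by
  unfold cauchyKer
  refine continuous_const.div (by fun_prop) fun y => ?_
  positivity

lemma smoothInd_eq {Em EU η : ℝ} (hη : 0 < η) (hE : Em ≤ EU) (x : ℝ) :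
    smoothInd Em EU η x =
      (Real.arctan ((x - Em) / η) - Real.arctan ((x - EU) / η)) / Real.pi := by
  have hind : (fun y => sharpInd Em EU (x - y) * cauchyKer η y) =
      Set.indicator (Set.Icc (x - EU) (x - Em)) (cauchyKer η) := by
    funext y
    have hmem : x - y ∈ Set.Icc Em EU ↔ y ∈ Set.Icc (x - EU) (x - Em) := by
      simp only [Set.mem_Icc]
      constructor <;> rintro ⟨h₁, h₂⟩ <;> constructor <;> linarith
    by_cases hy : y ∈ Set.Icc (x - EU) (x - Em)
    · simp [sharpInd, Set.indicator_of_mem hy, Set.indicator_of_mem (hmem.2 hy)]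
    · simp [sharpInd, Set.indicator_of_notMem hy, Set.indicator_of_notMem (mt hmem.1 hy)]
  rw [smoothInd, hind, integral_indicator measurableSet_Icc, integral_Icc_eq_integral_Ioc,
    ← intervalIntegral.integral_of_le (by linarith),
    intervalIntegral.integral_eq_sub_of_hasDerivAt
      (fun y _ => hasDerivAt_arctan_div_pi hη y)
      ((continuous_cauchyKer hη).intervalIntegrable _ _)]
  ring

lemma antitoneOn_arctan_add_two_div :
    AntitoneOn (fun u : ℝ => Real.arctan u + 2 / (1 + u)) (Set.Ici 0) := by
  have hderiv : ∀ u : ℝ, 0 ≤ u → HasDerivAt (fun u : ℝ => Real.arctan u + 2 / (1 + u))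
      (1 / (1 + u ^ 2) - 2 / (1 + u) ^ 2) u := by
    intro u hu
    have h := (Real.hasDerivAt_arctan u).add
      ((hasDerivAt_const u (2 : ℝ)).div ((hasDerivAt_id u).const_add 1) (by simp; positivity))
    refine h.congr_deriv ?_
    simp only [id]
    ring
  refine antitoneOn_of_deriv_nonpos (convex_Ici 0)
    (fun u hu => (hderiv u hu).continuousAt.continuousWithinAt)
    (fun u hu => ?_) fun u hu => ?_
  all_goals rw [interior_Ici, Set.mem_Ioi] at hu
  · exact (hderiv u hu.le).differentiableAt.differentiableWithinAt
  · rw [(hderiv u hu.le).deriv, sub_nonpos, div_le_div_iff₀ (by positivity) (by positivity)]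
    nlinarith [sq_nonneg (u - 1)]

lemma arctan_sub_arctan_le {u v : ℝ} (hu : 0 ≤ u) (huv : u ≤ v) :
    Real.arctan v - Real.arctan u ≤ 2 * ((v - u) / ((1 + u) * (1 + v))) := by
  have h := antitoneOn_arctan_add_two_div hu (hu.trans huv) huv
  have hv := hu.trans huv
  have heq : 2 * ((v - u) / ((1 + u) * (1 + v))) = 2 / (1 + u) - 2 / (1 + v) := by
    field_simp
    ring
  simp only at h
  linarith

lemma pi_div_two_sub_arctan_le {u : ℝ} (hu : 0 ≤ u) :
    Real.pi / 2 - Real.arctan u ≤ 2 / (1 + u) := by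
  have hlim := Real.tendsto_arctan_atTop.mono_right nhdsWithin_le_nhds
  have h : Real.pi / 2 ≤ Real.arctan u + 2 / (1 + u) := by
    refine le_of_tendsto hlim ?_
    filter_upwards [Filter.eventually_ge_atTop u] with v huv
    have hv : 0 ≤ v := hu.trans huv
    have hanti := antitoneOn_arctan_add_two_div hu hv huv
    have hpos : 0 ≤ 2 / (1 + v) := by positivity
    simp only at hanti
    linarith
  linarith

/-- Rescaling of the error bound to unit scale. -/
lemma mul_div_rescale {η : ℝ} (hη : 0 < η) {p q : ℝ} (hp : 0 ≤ p) (hq : 0 ≤ q) (r c : ℝ) :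
    8 * η * (r / ((p + η) * (q + η)) + c / ((p + η) + (q + η))) =
      8 * ((r / η) / ((1 + p / η) * (1 + q / η)) + c / (2 + p / η + q / η)) := by
  have h₁ : p + η = η * (1 + p / η) := by field_simp; ring
  have h₂ : q + η = η * (1 + q / η) := by field_simp; ring
  have h₃ : (p + η) + (q + η) = η * (2 + p / η + q / η) := by field_simp; ring
  have h₄ : 0 < 1 + p / η := by positivity
  have h₅ : 0 < 1 + q / η := by positivity
  have h₆ : 0 < 2 + p / η + q / η := by positivity
  rw [h₃, h₁, h₂]
  generalize 1 + p / η = P at *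
  generalize 1 + q / η = Q at *
  generalize 2 + p / η + q / η = R at *
  field_simp

lemma arctan_sub_arctan_div_pi_le {u v : ℝ} (hu : 0 ≤ u) (huv : u ≤ v) :
    |(Real.arctan v - Real.arctan u) / Real.pi| ≤ 8 * ((v - u) / ((1 + u) * (1 + v))) := by
  have hv := hu.trans huv
  have hpi := Real.pi_gt_three
  have hnn : 0 ≤ Real.arctan v - Real.arctan u := sub_nonneg.2 (Real.arctan_mono huv)
  have hq : 0 ≤ (v - u) / ((1 + u) * (1 + v)) :=
    div_nonneg (sub_nonneg.2 huv) (by positivity)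
  rw [abs_of_nonneg (by positivity), div_le_iff₀ Real.pi_pos]
  nlinarith [arctan_sub_arctan_le hu huv]

lemma one_sub_arctan_add_arctan_div_pi_le {u v : ℝ} (hu : 0 ≤ u) (hv : 0 ≤ v) :
    |1 - (Real.arctan u + Real.arctan v) / Real.pi| ≤
      8 * ((u + v) / ((1 + u) * (1 + v)) + 1 / (2 + u + v)) := by
  have hpi := Real.pi_gt_three
  have hu' := pi_div_two_sub_arctan_le hu
  have hv' := pi_div_two_sub_arctan_le hv
  have hkey : 2 / (1 + u) + 2 / (1 + v) ≤
      8 * ((u + v) / ((1 + u) * (1 + v)) + 1 / (2 + u + v)) := by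
    rw [div_add_div _ _ (by positivity) (by positivity),
      div_add_div _ _ (by positivity) (by positivity), ← mul_div_assoc,
      div_le_div_iff₀ (by positivity) (by positivity)]
    have : 2 * (1 + v) + (1 + u) * 2 ≤
        8 * ((u + v) * (2 + u + v) + (1 + u) * (1 + v) * 1) / (2 + u + v) := by
      rw [le_div_iff₀ (by positivity)]
      nlinarith [mul_nonneg hu hv, sq_nonneg u, sq_nonneg v]
    rw [le_div_iff₀ (by positivity)] at this
    nlinarith [mul_le_mul_of_nonneg_left this (by positivity : 0 ≤ (1 + u) * (1 + v))]
  have heq : 1 - (Real.arctan u + Real.arctan v) / Real.pi =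
      ((Real.pi / 2 - Real.arctan u) + (Real.pi / 2 - Real.arctan v)) / Real.pi := by
    field_simp
    ring
  have hnn : 0 ≤ (Real.pi / 2 - Real.arctan u) + (Real.pi / 2 - Real.arctan v) := by
    linarith [Real.arctan_lt_pi_div_two u, Real.arctan_lt_pi_div_two v]
  rw [heq, abs_of_nonneg (by positivity)]
  exact (div_le_self hnn (by linarith)).trans (by linarith)

/-- **Deterministic smoothing bound for the indicator of an interval**
(the lemma inside Appendix A): there is an absolute constant `C > 0` such that
`|𝒳_E(x) - (𝒳_E ∗ ϑ_{η̃})(x)| ≤ C η̃ [ (E_U - E⁻)/(d_U(x) d(x)) + 𝒳_E(x)/(d_U(x) + d(x)) ]`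
where `d(x) = |x - E⁻| + η̃`, `d_U(x) = |x - E_U| + η̃`. -/
theorem smoothing_bound_indicator :
    ∃ C : ℝ, 0 < C ∧
      ∀ ηt Em EU : ℝ, 0 < ηt → Em ≤ EU → ∀ x : ℝ,
        |sharpInd Em EU x - smoothInd Em EU ηt x| ≤
          C * ηt * ((EU - Em) / ((|x - EU| + ηt) * (|x - Em| + ηt)) +
            sharpInd Em EU x / ((|x - EU| + ηt) + (|x - Em| + ηt))) := by
  refine ⟨8, by norm_num, fun η Em EU hη hE x => ?_⟩
  rw [mul_div_rescale hη (abs_nonneg _) (abs_nonneg _), smoothInd_eq hη hE]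
  by_cases hx : x ∈ Set.Icc Em EU
  · have hone : sharpInd Em EU x = 1 := Set.indicator_of_mem hx _
    have hU : 0 ≤ (EU - x) / η := div_nonneg (sub_nonneg.2 hx.2) hη.le
    have hm : 0 ≤ (x - Em) / η := div_nonneg (sub_nonneg.2 hx.1) hη.le
    rw [hone, abs_of_nonpos (sub_nonpos.2 hx.2), abs_of_nonneg (sub_nonneg.2 hx.1), neg_sub]
    have harctan : Real.arctan ((x - EU) / η) = -Real.arctan ((EU - x) / η) := by
      rw [← Real.arctan_neg]
      ring_nf
    convert one_sub_arctan_add_arctan_div_pi_le hU hm using 4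
    · rw [harctan]
      ring
    · ring
  · have hzero : sharpInd Em EU x = 0 := Set.indicator_of_notMem hx _
    rw [hzero, zero_sub, abs_neg, zero_div, add_zero]
    rcases lt_or_ge x Em with hlt | hge
    · have hu : 0 ≤ (Em - x) / η := div_nonneg (by linarith) hη.le
      have huv : (Em - x) / η ≤ (EU - x) / η := by gcongr
      rw [abs_of_nonpos (by linarith : x - EU ≤ 0), abs_of_nonpos (by linarith : x - Em ≤ 0),
        neg_sub, neg_sub]
      convert arctan_sub_arctan_div_pi_le hu huv using 3
      · rw [← neg_sub Em x, ← neg_sub EU x, neg_div, neg_div, Real.arctan_neg, Real.arctan_neg]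
        ring
      · ring
      · ring
    · have hgt : EU < x := not_le.1 fun h => hx ⟨hge, h⟩
      have hu : 0 ≤ (x - EU) / η := div_nonneg (by linarith) hη.le
      have huv : (x - EU) / η ≤ (x - Em) / η := by gcongr
      rw [abs_of_nonneg (by linarith : 0 ≤ x - EU), abs_of_nonneg (by linarith : 0 ≤ x - Em)]
      convert arctan_sub_arctan_div_pi_le hu huv using 3
      ring

end
end
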